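/- Let W be a classical-quantum channel from a finite set 𝒳 to density matrices on ℂ^d and let W^{⊗n} denote its n-fold product channel on 𝒳^n, W^{⊗n}(x₁,…,x_n) := W(x₁) ⊗ ⋯ ⊗ W(x_n). Then for every t ∈ (−1/2, 0) ∪ (0, ∞), sup over probability distributions Q_{X^n} on 𝒳^n of Ĩ_{1+t}^{↓}(X^n;E^n | W^{⊗n} × Q_{X^n}) equals n times the sup over probability distributions Q_X on 𝒳 of Ĩ_{1+t}^{↓}(X;E | W × Q_X). -/

import Mathlib

open scoped Kronecker ComplexOrder
open Matrix

noncomputable section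

/-- Real power of a Hermitian matrix via functional calculus (junk value `0` otherwise). -/
def Matrix.hpow {n : Type*} [Fintype n] [DecidableEq n] (A : Matrix n n ℂ) (r : ℝ) :
    Matrix n n ℂ :=
  if hA : A.IsHermitian then
    (hA.eigenvectorUnitary : Matrix n n ℂ) *
      Matrix.diagonal (fun i => ((hA.eigenvalues i ^ r : ℝ) : ℂ)) *
      (hA.eigenvectorUnitary : Matrix n n ℂ)ᴴ
  else 0

/-- Trace norm ‖A‖₁ = Tr √(AᴴA). -/
def Matrix.traceNorm {n : Type*} [Fintype n] [DecidableEq n] (A : Matrix n n ℂ) : ℝ :=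
  ((Aᴴ * A).hpow (1/2)).trace.re

/-- Density matrix predicate. -/
def IsDensity {n : Type*} [Fintype n] (ρ : Matrix n n ℂ) : Prop :=
  ρ.PosSemidef ∧ ρ.trace = 1

/-- Probability distribution on a finite type. -/
def IsProbDist {X : Type*} [Fintype X] (Q : X → ℝ) : Prop :=
  (∀ x, 0 ≤ Q x) ∧ ∑ x, Q x = 1

/-- Tr[(σ^{−t/(2(1+t))} ρ σ^{−t/(2(1+t))})^{1+t}]. -/
def sandwichTr {n : Type*} [Fintype n] [DecidableEq n] (t : ℝ) (ρ σ : Matrix n n ℂ) : ℝ :=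
  (((σ.hpow (-(t / (2 * (1 + t)))) * ρ * σ.hpow (-(t / (2 * (1 + t))))).hpow (1 + t)).trace).re

/-- Ĩ_{1+t}^{↓}(X;E|W×Q), infimum over positive definite density matrices. -/
def ItildeDown {X n : Type*} [Fintype X] [Fintype n] [DecidableEq n]
    (t : ℝ) (W : X → Matrix n n ℂ) (Q : X → ℝ) : ℝ :=
  ⨅ σ : {σ : Matrix n n ℂ // σ.PosDef ∧ σ.trace = 1},
    (1 / t) * Real.logb 2 (∑ x, Q x * sandwichTr t (W x) σ.1)

/-- The uniform classical state on a finite type. -/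
def uniformState (T : Type*) [Fintype T] [DecidableEq T] : Matrix T T ℂ :=
  (Fintype.card T : ℂ)⁻¹ • 1


/-- The `n`-fold product channel: `W^n(x₁,…,xₙ) = W(x₁) ⊗ ⋯ ⊗ W(xₙ)`. -/
def prodChannel {X : Type*} {d : ℕ} (W : X → Matrix (Fin d) (Fin d) ℂ) (n : ℕ) :
    (Fin n → X) → Matrix (Fin n → Fin d) (Fin n → Fin d) ℂ :=
  fun xs => Matrix.of fun i j => ∏ k, W (xs k) (i k) (j k)


/-- `U diag(a) Uᴴ`. -/
def DD {m : Type*} [Fintype m] [DecidableEq m] (U : Matrix m m ℂ) (a : m → ℝ) : Matrix m m ℂ :=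
  U * Matrix.diagonal (fun i => ((a i : ℝ) : ℂ)) * Uᴴ

/-- unitarity. -/
def IsU {m : Type*} [Fintype m] [DecidableEq m] (U : Matrix m m ℂ) : Prop :=
  Uᴴ * U = 1 ∧ U * Uᴴ = 1

/-- real trace of a real power. -/
def trp {m : Type*} [Fintype m] [DecidableEq m] (A : Matrix m m ℂ) (r : ℝ) : ℝ :=
  (A.hpow r).trace.re

section spectral
variable {m : Type*} [Fintype m] [DecidableEq m]

lemma isU_eig {A : Matrix m m ℂ} (hA : A.IsHermitian) :
    IsU (hA.eigenvectorUnitary : Matrix m m ℂ) := by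
  constructor
  · have := Unitary.coe_star_mul_self hA.eigenvectorUnitary
    simpa [Matrix.star_eq_conjTranspose] using this
  · have := Unitary.coe_mul_star_self hA.eigenvectorUnitary
    simpa [Matrix.star_eq_conjTranspose] using this

lemma eq_DD_eig {A : Matrix m m ℂ} (hA : A.IsHermitian) :
    A = DD (hA.eigenvectorUnitary : Matrix m m ℂ) hA.eigenvalues := by
  conv_lhs => rw [hA.spectral_theorem, Unitary.conjStarAlgAut_apply]
  rfl

lemma DD_uniq {U V : Matrix m m ℂ} {a b : m → ℝ} (hU : IsU U) (hV : IsU V)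
    (h : DD U a = DD V b) (f : ℝ → ℝ) :
    DD U (fun i => f (a i)) = DD V (fun i => f (b i)) := by
  have key : (Vᴴ * U) * diagonal (fun i => ((a i : ℝ) : ℂ))
      = diagonal (fun i => ((b i : ℝ) : ℂ)) * (Vᴴ * U) := by
    have h2 := congrArg (fun M => Vᴴ * M * U) h
    simp only [DD] at h2
    calc _ = Vᴴ * (U * diagonal (fun i => ((a i : ℝ) : ℂ)) * Uᴴ) * U := by
          simp only [Matrix.mul_assoc]; rw [hU.1]; simp
      _ = _ := by
          rw [h2]; simp only [Matrix.mul_assoc]; rw [← Matrix.mul_assoc Vᴴ V, hV.1]; simp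
  have key2 : (Vᴴ * U) * diagonal (fun i => ((f (a i) : ℝ) : ℂ))
      = diagonal (fun i => ((f (b i) : ℝ) : ℂ)) * (Vᴴ * U) := by
    ext i j
    have := congrFun (congrFun key i) j
    rw [Matrix.mul_diagonal, Matrix.diagonal_mul] at this ⊢
    by_cases h0 : (Vᴴ * U) i j = 0
    · simp [h0]
    · rw [mul_comm] at this
      have h3 := mul_right_cancel₀ h0 this
      have h4 : a j = b i := by exact_mod_cast h3
      rw [h4, mul_comm]
  have h5 := congrArg (fun M => V * M * Uᴴ) key2
  simp only [DD]
  calc _ = V * (Vᴴ * U * diagonal (fun i => ((f (a i) : ℝ) : ℂ))) * Uᴴ := by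
        simp only [← Matrix.mul_assoc]; rw [hV.2]; simp
    _ = _ := by
        rw [h5]; simp only [Matrix.mul_assoc]; rw [hU.2]; simp

lemma DD_herm (U : Matrix m m ℂ) (a : m → ℝ) : (DD U a).IsHermitian := by
  unfold DD Matrix.IsHermitian
  simp only [conjTranspose_mul, conjTranspose_conjTranspose, diagonal_conjTranspose, Matrix.mul_assoc]
  congr 3
  ext i; simp

lemma hpow_DD {U : Matrix m m ℂ} {a : m → ℝ} (hU : IsU U) (r : ℝ) :
    (DD U a).hpow r = DD U (fun i => a i ^ r) := by
  have hH := DD_herm U a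
  have h1 : (DD U a).hpow r = DD (hH.eigenvectorUnitary : Matrix m m ℂ)
      (fun i => hH.eigenvalues i ^ r) := by
    unfold Matrix.hpow; rw [dif_pos hH]; rfl
  rw [h1]
  exact (DD_uniq hU (isU_eig hH) (eq_DD_eig hH) (fun x => x ^ r)).symm

lemma DD_mul {U : Matrix m m ℂ} (hU : IsU U) (a b : m → ℝ) :
    DD U a * DD U b = DD U (fun i => a i * b i) := by
  unfold DD
  calc _ = U * diagonal (fun i => ((a i : ℝ) : ℂ)) * (Uᴴ * U) * diagonal (fun i => ((b i : ℝ) : ℂ)) * Uᴴ := by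
        simp only [Matrix.mul_assoc]
    _ = _ := by
        rw [hU.1, Matrix.mul_one, Matrix.mul_assoc U, diagonal_mul_diagonal]
        simp

lemma DD_add (U : Matrix m m ℂ) (a b : m → ℝ) :
    DD U a + DD U b = DD U (fun i => a i + b i) := by
  unfold DD
  rw [← Matrix.add_mul, ← Matrix.mul_add, diagonal_add]
  simp

lemma DD_smul (U : Matrix m m ℂ) (c : ℝ) (a : m → ℝ) :
    c • DD U a = DD U (fun i => c * a i) := by
  unfold DD
  rw [← Matrix.smul_mul, ← Matrix.mul_smul]
  congr 2
  ext i j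
  simp [diagonal_apply]

lemma DD_const {U : Matrix m m ℂ} (hU : IsU U) (c : ℝ) :
    DD U (fun _ => c) = c • (1 : Matrix m m ℂ) := by
  have : (fun _ : m => c) = fun i => c * (fun _ : m => (1:ℝ)) i := by ext; simp
  rw [this, ← DD_smul]
  congr 1
  unfold DD
  simp [hU.2]

lemma DD_trace {U : Matrix m m ℂ} (hU : IsU U) (a : m → ℝ) :
    (DD U a).trace = ((∑ i, a i : ℝ) : ℂ) := by
  unfold DD
  rw [Matrix.trace_mul_comm, ← Matrix.mul_assoc, hU.1, Matrix.one_mul, Matrix.trace_diagonal]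
  simp

lemma DD_psd {U : Matrix m m ℂ} {a : m → ℝ} (ha : ∀ i, 0 ≤ a i) :
    (DD U a).PosSemidef := by
  unfold DD
  apply PosSemidef.mul_mul_conjTranspose_same
  rw [posSemidef_diagonal_iff]
  intro i
  exact_mod_cast ha i

lemma DD_pd {U : Matrix m m ℂ} (hU : IsU U) {a : m → ℝ} (ha : ∀ i, 0 < a i) :
    (DD U a).PosDef := by
  unfold DD
  apply PosDef.mul_mul_conjTranspose_same
  · rw [posDef_diagonal_iff]
    intro i
    exact_mod_cast ha i
  · intro x y hxy
    have := congrArg (fun v => v ᵥ* Uᴴ) hxy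
    simpa [Matrix.vecMul_vecMul, hU.2] using this

lemma exists_psd {A : Matrix m m ℂ} (hA : A.PosSemidef) :
    ∃ U a, IsU U ∧ (∀ i, 0 ≤ a i) ∧ A = DD U a :=
  ⟨_, _, isU_eig hA.1, hA.eigenvalues_nonneg, eq_DD_eig hA.1⟩

lemma exists_pd {A : Matrix m m ℂ} (hA : A.PosDef) :
    ∃ U a, IsU U ∧ (∀ i, 0 < a i) ∧ A = DD U a :=
  ⟨_, _, isU_eig hA.1, hA.eigenvalues_pos, eq_DD_eig hA.1⟩

lemma trp_DD {U : Matrix m m ℂ} {a : m → ℝ} (hU : IsU U) (r : ℝ) :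
    trp (DD U a) r = ∑ i, a i ^ r := by
  unfold trp; rw [hpow_DD hU, DD_trace hU]; simp

lemma trp_one {A : Matrix m m ℂ} (hA : A.PosSemidef) : trp A 1 = A.trace.re := by
  obtain ⟨U, a, hU, ha, rfl⟩ := exists_psd hA
  rw [trp_DD hU, DD_trace hU]; simp

lemma trp_nonneg {A : Matrix m m ℂ} (hA : A.PosSemidef) (r : ℝ) : 0 ≤ trp A r := by
  obtain ⟨U, a, hU, ha, rfl⟩ := exists_psd hA
  rw [trp_DD hU]
  exact Finset.sum_nonneg fun i _ => Real.rpow_nonneg (ha i) _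

lemma trp_pos {A : Matrix m m ℂ} (hA : A.PosSemidef) (r : ℝ) (h : 0 < A.trace.re) :
    0 < trp A r := by
  obtain ⟨U, a, hU, ha, rfl⟩ := exists_psd hA
  rw [trp_DD hU]
  rw [DD_trace hU, Complex.ofReal_re] at h
  obtain ⟨i, hi, h2⟩ := Finset.exists_lt_of_sum_lt (s := Finset.univ) (f := fun _ => (0:ℝ)) (g := a)
    (by simpa using h)
  exact Finset.sum_pos' (fun i _ => Real.rpow_nonneg (ha i) _) ⟨i, hi, Real.rpow_pos_of_pos h2 _⟩

/-- overlap matrix of two unitaries -/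
lemma exists_overlap {U V : Matrix m m ℂ} (hU : IsU U) (hV : IsU V) :
    ∃ w : m → m → ℝ, (∀ i j, 0 ≤ w i j) ∧ (∀ i, ∑ j, w i j = 1) ∧ (∀ j, ∑ i, w i j = 1) ∧
      ∀ x y : m → ℝ, (DD U x * DD V y).trace.re = ∑ i, ∑ j, w i j * (x i * y j) := by
  set T := Uᴴ * V with hT
  have hT1 : T * Tᴴ = 1 := by
    rw [hT, conjTranspose_mul, conjTranspose_conjTranspose]
    rw [Matrix.mul_assoc, ← Matrix.mul_assoc V, hV.2, Matrix.one_mul, hU.1]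
  have hT2 : Tᴴ * T = 1 := by
    rw [hT, conjTranspose_mul, conjTranspose_conjTranspose]
    rw [Matrix.mul_assoc, ← Matrix.mul_assoc U, hU.2, Matrix.one_mul, hV.1]
  have hns : ∀ z : ℂ, z * star z = ((Complex.normSq z : ℝ) : ℂ) := fun z => by
    rw [← Complex.mul_conj]; rfl
  refine ⟨fun i j => Complex.normSq (T i j), fun i j => Complex.normSq_nonneg _, ?_, ?_, ?_⟩
  · intro i
    have := congrFun (congrFun hT1 i) i
    simp only [Matrix.mul_apply, conjTranspose_apply, hns, one_apply_eq] at this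
    exact_mod_cast this
  · intro i
    have := congrFun (congrFun hT2 i) i
    simp only [Matrix.mul_apply, conjTranspose_apply, one_apply_eq] at this
    simp only [mul_comm (star _), hns] at this
    exact_mod_cast this
  · intro x y
    have h1 : (DD U x * DD V y).trace
        = (diagonal (fun i => ((x i : ℝ) : ℂ)) * T * diagonal (fun i => ((y i : ℝ) : ℂ)) * Tᴴ).trace := by
      unfold DD
      rw [Matrix.mul_assoc U, Matrix.mul_assoc U, Matrix.trace_mul_comm U]
      congr 1
      rw [hT, conjTranspose_mul, conjTranspose_conjTranspose]
      simp only [Matrix.mul_assoc]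
    have h2 : (DD U x * DD V y).trace
        = ((∑ i, ∑ j, Complex.normSq (T i j) * (x i * y j) : ℝ) : ℂ) := by
      rw [h1, Matrix.trace]
      push_cast
      apply Finset.sum_congr rfl
      intro i _
      rw [Matrix.diag_apply, Matrix.mul_apply]
      apply Finset.sum_congr rfl
      intro j _
      rw [Matrix.mul_diagonal, Matrix.diagonal_mul, conjTranspose_apply, ← hns]
      ring
    rw [h2, Complex.ofReal_re]

lemma trp_mul_comm (Y : Matrix m m ℂ) (r : ℝ) : trp (Y * Yᴴ) r = trp (Yᴴ * Y) r := by
  have h1 : (Y * Yᴴ).IsHermitian := isHermitian_mul_conjTranspose_self Y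
  have h2 : (Yᴴ * Y).IsHermitian := isHermitian_conjTranspose_mul_self Y
  have h3 : h1.eigenvalues = h2.eigenvalues :=
    (Matrix.IsHermitian.eigenvalues_eq_eigenvalues_iff h1 h2).2 (charpoly_mul_comm _ _)
  have e1 := eq_DD_eig h1
  have e2 := eq_DD_eig h2
  rw [e1, e2, trp_DD (isU_eig h1), trp_DD (isU_eig h2), h3]

end spectral


lemma scal_fwd {ι : Type*} [Fintype ι] (w a b : ι → ℝ) (hw : ∀ i, 0 ≤ w i) (ha : ∀ i, 0 ≤ a i)
    (hb : ∀ i, 0 ≤ b i) {q : ℝ} (hq : 1 < q) (hB : ∑ i, w i * b i ^ (q / (q - 1)) ≤ 1) :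
    (∑ i, w i * (a i * b i)) ^ q ≤ ∑ i, w i * a i ^ q := by
  have hq0 : 0 < q := by linarith
  have hq1 : 0 < q - 1 := by linarith
  have hc : q.HolderConjugate (q / (q - 1)) := Real.HolderConjugate.conjExponent hq
  have h := Real.inner_le_Lp_mul_Lq_of_nonneg Finset.univ hc
    (f := fun i => w i ^ (1 / q) * a i) (g := fun i => w i ^ (1 / (q / (q - 1))) * b i)
    (fun i _ => mul_nonneg (Real.rpow_nonneg (hw i) _) (ha i))
    (fun i _ => mul_nonneg (Real.rpow_nonneg (hw i) _) (hb i))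
  have e1 : ∀ i, w i ^ (1 / q) * a i * (w i ^ (1 / (q / (q - 1))) * b i) = w i * (a i * b i) := by
    intro i
    have : w i ^ (1 / q) * w i ^ (1 / (q / (q - 1))) = w i := by
      rw [← Real.rpow_add_of_nonneg (hw i) (by positivity) (by positivity)]
      have : 1 / q + 1 / (q / (q - 1)) = 1 := by field_simp; ring
      rw [this, Real.rpow_one]
    calc _ = (w i ^ (1 / q) * w i ^ (1 / (q / (q - 1)))) * (a i * b i) := by ring
      _ = _ := by rw [this]
  have e2 : ∀ i, (w i ^ (1 / q) * a i) ^ q = w i * a i ^ q := by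
    intro i
    rw [Real.mul_rpow (Real.rpow_nonneg (hw i) _) (ha i), ← Real.rpow_mul (hw i)]
    rw [one_div_mul_cancel hq0.ne', Real.rpow_one]
  have e3 : ∀ i, (w i ^ (1 / (q / (q - 1))) * b i) ^ (q / (q - 1)) = w i * b i ^ (q / (q - 1)) := by
    intro i
    rw [Real.mul_rpow (Real.rpow_nonneg (hw i) _) (hb i), ← Real.rpow_mul (hw i)]
    rw [one_div_mul_cancel (by positivity), Real.rpow_one]
  simp only [e1, e2, e3] at h
  have hS : 0 ≤ ∑ i, w i * a i ^ q :=
    Finset.sum_nonneg fun i _ => mul_nonneg (hw i) (Real.rpow_nonneg (ha i) _)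
  have hBn : 0 ≤ ∑ i, w i * b i ^ (q / (q - 1)) :=
    Finset.sum_nonneg fun i _ => mul_nonneg (hw i) (Real.rpow_nonneg (hb i) _)
  have h2 : (∑ i, w i * b i ^ (q / (q - 1))) ^ (1 / (q / (q - 1))) ≤ 1 :=
    Real.rpow_le_one hBn hB (by positivity)
  have h3 : ∑ i, w i * (a i * b i) ≤ (∑ i, w i * a i ^ q) ^ (1 / q) :=
    h.trans (mul_le_of_le_one_right (Real.rpow_nonneg hS _) h2)
  have h4 : 0 ≤ ∑ i, w i * (a i * b i) :=
    Finset.sum_nonneg fun i _ => mul_nonneg (hw i) (mul_nonneg (ha i) (hb i))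
  calc _ ≤ ((∑ i, w i * a i ^ q) ^ (1 / q)) ^ q := Real.rpow_le_rpow h4 h3 hq0.le
    _ = _ := by rw [← Real.rpow_mul hS, one_div_mul_cancel hq0.ne', Real.rpow_one]

lemma scal_rev {ι : Type*} [Fintype ι] (w a b : ι → ℝ) (hw : ∀ i, 0 ≤ w i) (ha : ∀ i, 0 ≤ a i)
    (hb : ∀ i, 0 < b i) {q : ℝ} (hq0 : 0 < q) (hq : q < 1)
    (hB : ∑ i, w i * b i ^ (q / (q - 1)) ≤ 1) :
    ∑ i, w i * a i ^ q ≤ (∑ i, w i * (a i * b i)) ^ q := by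
  have hq1 : 0 < 1 - q := by linarith
  have hq2 : q - 1 ≠ 0 := by linarith
  have hqi : 1 < 1 / q := by rw [lt_div_iff₀ hq0]; linarith
  have h := scal_fwd w (fun i => (a i * b i) ^ q) (fun i => b i ^ (-q)) hw
    (fun i => Real.rpow_nonneg (mul_nonneg (ha i) (hb i).le) _)
    (fun i => Real.rpow_nonneg (hb i).le _) hqi (by
      convert hB using 3 with i
      rw [← Real.rpow_mul (hb i).le]
      congr 1
      have : 1 / q - 1 ≠ 0 := by linarith
      field_simp
      ring)
  have e1 : ∀ i, (a i * b i) ^ q * b i ^ (-q) = a i ^ q := by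
    intro i
    rw [Real.mul_rpow (ha i) (hb i).le, mul_assoc, ← Real.rpow_add (hb i)]
    simp
  have e2 : ∀ i, ((a i * b i) ^ q) ^ (1 / q) = a i * b i := by
    intro i
    rw [← Real.rpow_mul (mul_nonneg (ha i) (hb i).le), mul_one_div_cancel hq0.ne', Real.rpow_one]
  simp only [e1, e2] at h
  have hS : 0 ≤ ∑ i, w i * a i ^ q :=
    Finset.sum_nonneg fun i _ => mul_nonneg (hw i) (Real.rpow_nonneg (ha i) _)
  have := Real.rpow_le_rpow (Real.rpow_nonneg hS _) h hq0.le
  rwa [← Real.rpow_mul hS, one_div_mul_cancel hq0.ne', Real.rpow_one] at this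

section mats
variable {m : Type*} [Fintype m] [DecidableEq m]

lemma holder_fwd {A B : Matrix m m ℂ} (hA : A.PosSemidef) (hB : B.PosSemidef) {q : ℝ} (hq : 1 < q)
    (h : trp B (q / (q - 1)) ≤ 1) : ((A * B).trace.re) ^ q ≤ trp A q := by
  obtain ⟨U, a, hU, ha, rfl⟩ := exists_psd hA
  obtain ⟨V, b, hV, hb, rfl⟩ := exists_psd hB
  obtain ⟨w, hw, hr, hc, ht⟩ := exists_overlap hU hV
  rw [trp_DD hV] at h
  rw [trp_DD hU, ht]
  have := scal_fwd (ι := m × m) (fun k => w k.1 k.2) (fun k => a k.1) (fun k => b k.2)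
    (fun k => hw _ _) (fun k => ha _) (fun k => hb _) hq (by
      rw [Fintype.sum_prod_type_right]
      simpa only [← Finset.sum_mul, hc, one_mul] using h)
  rw [Fintype.sum_prod_type, Fintype.sum_prod_type] at this
  simpa only [← Finset.sum_mul, hr, one_mul] using this

lemma holder_rev {A B : Matrix m m ℂ} (hA : A.PosSemidef) (hB : B.PosDef) {q : ℝ} (hq0 : 0 < q)
    (hq : q < 1) (h : trp B (q / (q - 1)) ≤ 1) : trp A q ≤ ((A * B).trace.re) ^ q := by
  obtain ⟨U, a, hU, ha, rfl⟩ := exists_psd hA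
  obtain ⟨V, b, hV, hb, rfl⟩ := exists_pd hB
  obtain ⟨w, hw, hr, hc, ht⟩ := exists_overlap hU hV
  rw [trp_DD hV] at h
  rw [trp_DD hU, ht]
  have := scal_rev (ι := m × m) (fun k => w k.1 k.2) (fun k => a k.1) (fun k => b k.2)
    (fun k => hw _ _) (fun k => ha _) (fun k => hb _) hq0 hq (by
      rw [Fintype.sum_prod_type_right]
      simpa only [← Finset.sum_mul, hc, one_mul] using h)
  rw [Fintype.sum_prod_type, Fintype.sum_prod_type] at this
  simpa only [← Finset.sum_mul, hr, one_mul] using this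

lemma trace_mul_nonneg {A B : Matrix m m ℂ} (hA : A.PosSemidef) (hB : B.PosSemidef) :
    0 ≤ (A * B).trace.re := by
  obtain ⟨U, a, hU, ha, rfl⟩ := exists_psd hA
  obtain ⟨V, b, hV, hb, rfl⟩ := exists_psd hB
  obtain ⟨w, hw, hr, hc, ht⟩ := exists_overlap hU hV
  rw [ht]
  exact Finset.sum_nonneg fun i _ => Finset.sum_nonneg fun j _ =>
    mul_nonneg (hw _ _) (mul_nonneg (ha i) (hb j))

/-- if the eigenvalues of `B` are at most `c`, `Tr AB ≤ c Tr A` -/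
lemma trace_mul_le {A : Matrix m m ℂ} (hA : A.PosSemidef) {V : Matrix m m ℂ} (hV : IsU V)
    {b : m → ℝ} {c : ℝ} (hb : ∀ i, b i ≤ c) :
    (A * DD V b).trace.re ≤ c * A.trace.re := by
  obtain ⟨U, a, hU, ha, rfl⟩ := exists_psd hA
  obtain ⟨w, hw, hr, hc, ht⟩ := exists_overlap hU hV
  rw [ht, DD_trace hU, Complex.ofReal_re, Finset.mul_sum]
  apply Finset.sum_le_sum
  intro i _
  calc ∑ j, w i j * (a i * b j) ≤ ∑ j, w i j * (a i * c) := by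
        apply Finset.sum_le_sum
        intro j _
        exact mul_le_mul_of_nonneg_left (mul_le_mul_of_nonneg_left (hb j) (ha i)) (hw i j)
    _ = c * a i := by rw [← Finset.sum_mul, hr]; ring

lemma hpow_pd {A : Matrix m m ℂ} (hA : A.PosDef) (r : ℝ) : (A.hpow r).PosDef := by
  obtain ⟨U, a, hU, ha, rfl⟩ := exists_pd hA
  rw [hpow_DD hU]
  exact DD_pd hU fun i => Real.rpow_pos_of_pos (ha i) _

lemma sandwichTr_eq {t : ℝ} {W X σ : Matrix m m ℂ} (hW : W = X * Xᴴ)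
    (hσ : σ.PosDef) :
    sandwichTr t W σ = trp (Xᴴ * σ.hpow (-(t / (1 + t))) * X) (1 + t) := by
  obtain ⟨U, a, hU, ha, rfl⟩ := exists_pd hσ
  set H := (DD U a).hpow (-(t / (2 * (1 + t)))) with hH
  have hHH : Hᴴ = H := by rw [hH, hpow_DD hU]; exact DD_herm _ _
  have h2 : H * H = (DD U a).hpow (-(t / (1 + t))) := by
    rw [hH, hpow_DD hU, hpow_DD hU, DD_mul hU]
    congr 1
    ext i
    rw [← Real.rpow_add (ha i)]
    congr 1
    by_cases h : 1 + t = 0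
    · simp [h]
    field_simp
    ring
  have h3 := trp_mul_comm (H * X) (1 + t)
  rw [conjTranspose_mul, hHH] at h3
  unfold sandwichTr
  rw [← hH, hW, ← h2]
  unfold trp at h3 ⊢
  simp only [Matrix.mul_assoc] at h3 ⊢
  exact h3

end mats


set_option linter.unusedSectionVars false

lemma jensen_neg {ι : Type*} [Fintype ι] (p z : ι → ℝ) (hp : ∀ i, 0 ≤ p i) (hp1 : ∑ i, p i = 1)
    (hz : ∀ i, 0 ≤ z i) {q : ℝ} (hq0 : 0 < q) (hq : q ≤ 1) :
    ∑ i, p i * z i ^ q ≤ (∑ i, p i * z i) ^ q := by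
  have h := Real.rpow_arith_mean_le_arith_mean_rpow Finset.univ p (fun i => z i ^ q)
    (fun i _ => hp i) hp1 (fun i _ => Real.rpow_nonneg (hz i) _) (p := 1 / q)
    (by rw [le_div_iff₀ hq0]; linarith)
  have e : ∀ i, (z i ^ q) ^ (1 / q) = z i := fun i => by
    rw [← Real.rpow_mul (hz i), mul_one_div_cancel hq0.ne', Real.rpow_one]
  simp only [e] at h
  have hS : 0 ≤ ∑ i, p i * z i ^ q :=
    Finset.sum_nonneg fun i _ => mul_nonneg (hp i) (Real.rpow_nonneg (hz i) _)
  have := Real.rpow_le_rpow (Real.rpow_nonneg hS _) h hq0.le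
  rwa [← Real.rpow_mul hS, one_div_mul_cancel hq0.ne', Real.rpow_one] at this

/-- admissible parameters -/
def Adm (t : ℝ) : Prop := -(1/2) < t ∧ t ≠ 0

section weak
variable {m : Type*} [Fintype m] [DecidableEq m]

lemma psd_sum_smul {ι : Type*} [Fintype ι] (p : ι → ℝ) (Z : ι → Matrix m m ℂ) (hp : ∀ i, 0 ≤ p i)
    (hZ : ∀ i, (Z i).PosSemidef) : (∑ i, p i • Z i).PosSemidef := by
  apply Matrix.posSemidef_sum
  intro i _
  exact (hZ i).smul (hp i)

lemma trp_hpow_neg {σ : Matrix m m ℂ} (hσ : σ.PosDef) (h1 : σ.trace = 1) {t : ℝ} (ht : Adm t) :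
    trp (σ.hpow (-(t / (1 + t)))) (((1 + t) / (1 + 2 * t)) / ((1 + t) / (1 + 2 * t) - 1)) = 1 := by
  obtain ⟨ht1, ht0⟩ := ht
  have e : ((1 + t) / (1 + 2 * t)) / ((1 + t) / (1 + 2 * t) - 1) = - ((1 + t) / t) := by
    have : 1 + 2 * t ≠ 0 := by linarith
    have : 1 + t * 2 ≠ 0 := by linarith
    have h2 : (1 + t) / (1 + 2 * t) - 1 = - t / (1 + 2 * t) := by field_simp; ring
    rw [h2]
    field_simp
  rw [e]
  obtain ⟨U, a, hU, ha, rfl⟩ := exists_pd hσ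
  rw [hpow_DD hU, trp_DD hU]
  rw [DD_trace hU] at h1
  have h3 : ∑ i, a i = 1 := by exact_mod_cast h1
  refine Eq.trans ?_ h3
  apply Finset.sum_congr rfl
  intro i _
  rw [← Real.rpow_mul (ha i).le]
  have : -(t / (1 + t)) * -((1 + t) / t) = 1 := by
    have : 1 + t ≠ 0 := by linarith
    field_simp
  rw [this, Real.rpow_one]

lemma weak_duality {ι : Type*} [Fintype ι] {t : ℝ} (ht : Adm t) (p : ι → ℝ)
    (W X B : ι → Matrix m m ℂ) (hp : ∀ i, 0 ≤ p i) (hp1 : ∑ i, p i = 1)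
    (hW : ∀ i, W i = X i * (X i)ᴴ) (hB : ∀ i, (B i).PosSemidef) (hB' : t < 0 → ∀ i, (B i).PosDef)
    (hBt : ∀ i, trp (B i) ((1 + t) / t) ≤ 1) {σ : Matrix m m ℂ} (hσ : σ.PosDef)
    (hσ1 : σ.trace = 1) :
    t * (trp (∑ i, p i • (X i * B i * (X i)ᴴ)) ((1 + t) / (1 + 2 * t))) ^ (1 + 2 * t)
      ≤ t * ∑ i, p i * sandwichTr t (W i) σ := by
  have hS1 := (trp_hpow_neg hσ hσ1 ht).le
  obtain ⟨ht1, ht0⟩ := ht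
  set S := σ.hpow (-(t / (1 + t))) with hS
  have hSpd : S.PosDef := hpow_pd hσ _
  set K := ∑ i, p i • (X i * B i * (X i)ᴴ) with hK
  have hKpsd : K.PosSemidef := psd_sum_smul p _ hp fun i => (hB i).mul_mul_conjTranspose_same _
  have hA : ∀ i, ((X i)ᴴ * S * X i).PosSemidef := fun i =>
    hSpd.posSemidef.conjTranspose_mul_mul_same _
  have hKS : (K * S).trace.re = ∑ i, p i * (((X i)ᴴ * S * X i) * B i).trace.re := by
    rw [hK, Finset.sum_mul, Matrix.trace_sum, Complex.re_sum]
    apply Finset.sum_congr rfl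
    intro i _
    rw [Matrix.smul_mul, Matrix.trace_smul, Complex.smul_re, smul_eq_mul]
    congr 2
    rw [Matrix.mul_assoc, Matrix.mul_assoc, Matrix.trace_mul_comm, Matrix.mul_assoc,
      Matrix.trace_mul_comm]
  have hz : ∀ i, 0 ≤ (((X i)ᴴ * S * X i) * B i).trace.re := fun i => trace_mul_nonneg (hA i) (hB i)
  have hKS0 : 0 ≤ (K * S).trace.re := trace_mul_nonneg hKpsd hSpd.posSemidef
  have hexp : (1 + t) / ((1 + t) - 1) = (1 + t) / t := by ring_nf
  have h12 : 0 < 1 + 2 * t := by linarith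
  have hpq : (1 + t) / (1 + 2 * t) * (1 + 2 * t) = 1 + t := div_mul_cancel₀ _ h12.ne'
  have hκ := trp_nonneg hKpsd ((1 + t) / (1 + 2 * t))
  simp only [fun i => sandwichTr_eq (t := t) (hW i) hσ]
  rw [← hS]
  rcases lt_or_gt_of_ne ht0 with h | h
  · apply mul_le_mul_of_nonpos_left _ h.le
    have h1 : ∀ i, trp ((X i)ᴴ * S * X i) (1 + t) ≤ ((((X i)ᴴ * S * X i) * B i).trace.re) ^ (1 + t) :=
      fun i => holder_rev (hA i) (hB' h i) (by linarith) (by linarith) (by rw [hexp]; exact hBt i)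
    have h2 := holder_fwd hKpsd hSpd.posSemidef (q := (1 + t) / (1 + 2 * t))
      (by rw [lt_div_iff₀ h12]; linarith) hS1
    calc _ ≤ ∑ i, p i * ((((X i)ᴴ * S * X i) * B i).trace.re) ^ (1 + t) :=
          Finset.sum_le_sum fun i _ => mul_le_mul_of_nonneg_left (h1 i) (hp i)
      _ ≤ (∑ i, p i * (((X i)ᴴ * S * X i) * B i).trace.re) ^ (1 + t) :=
          jensen_neg p _ hp hp1 hz (by linarith) (by linarith)
      _ = ((K * S).trace.re ^ ((1 + t) / (1 + 2 * t))) ^ (1 + 2 * t) := by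
          rw [← hKS, ← Real.rpow_mul hKS0, hpq]
      _ ≤ _ := Real.rpow_le_rpow (Real.rpow_nonneg hKS0 _) h2 h12.le
  · apply mul_le_mul_of_nonneg_left _ h.le
    have h1 : ∀ i, ((((X i)ᴴ * S * X i) * B i).trace.re) ^ (1 + t) ≤ trp ((X i)ᴴ * S * X i) (1 + t) :=
      fun i => holder_fwd (hA i) (hB i) (by linarith) (by rw [hexp]; exact hBt i)
    have h2 := holder_rev hKpsd hSpd (q := (1 + t) / (1 + 2 * t)) (by positivity)
      (by rw [div_lt_iff₀ h12]; linarith) hS1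
    calc _ ≤ ((K * S).trace.re ^ ((1 + t) / (1 + 2 * t))) ^ (1 + 2 * t) :=
          Real.rpow_le_rpow hκ h2 h12.le
      _ = (∑ i, p i * (((X i)ᴴ * S * X i) * B i).trace.re) ^ (1 + t) := by
          rw [← hKS, ← Real.rpow_mul hKS0, hpq]
      _ ≤ ∑ i, p i * ((((X i)ᴴ * S * X i) * B i).trace.re) ^ (1 + t) :=
          Real.rpow_arith_mean_le_arith_mean_rpow Finset.univ p _ (fun i _ => hp i) hp1
            (fun i _ => hz i) (by linarith)
      _ ≤ _ := Finset.sum_le_sum fun i _ => mul_le_mul_of_nonneg_left (h1 i) (hp i)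

lemma exists_sqrt {W : Matrix m m ℂ} (hW : W.PosSemidef) : ∃ X : Matrix m m ℂ, W = X * Xᴴ := by
  obtain ⟨U, a, hU, ha, rfl⟩ := exists_psd hW
  refine ⟨DD U (fun i => √(a i)), ?_⟩
  rw [(DD_herm U _).eq, DD_mul hU]
  congr 1
  ext i
  exact (Real.mul_self_sqrt (ha i)).symm

lemma isU_one : IsU (1 : Matrix m m ℂ) := by constructor <;> simp

/-- a scalar admissible `B` -/
lemma exists_scalarB [Nonempty m] {t : ℝ} (ht : Adm t) : ∃ β : ℝ, 0 < β ∧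
    trp (β • (1 : Matrix m m ℂ)) ((1 + t) / t) ≤ 1 ∧ (β • (1 : Matrix m m ℂ)).PosDef := by
  obtain ⟨ht1, ht0⟩ := ht
  have hc : (0:ℝ) < Fintype.card m := by exact_mod_cast Fintype.card_pos
  refine ⟨(1 / (Fintype.card m : ℝ)) ^ (t / (1 + t)), by positivity, ?_, ?_⟩
  · rw [← DD_const isU_one, trp_DD isU_one, ← Real.rpow_mul (by positivity)]
    have : t / (1 + t) * ((1 + t) / t) = 1 := by
      have : 1 + t ≠ 0 := by linarith
      field_simp
    rw [this]
    simp
  · rw [← DD_const isU_one]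
    exact DD_pd isU_one fun i => by positivity

/-- dual witness -/
def DualWit {Y : Type*} (t : ℝ) (W : Y → Matrix m m ℂ) (κ : ℝ) : Prop :=
  ∃ (ι : Type) (_ : Fintype ι) (p : ι → ℝ) (y : ι → Y) (X B : ι → Matrix m m ℂ),
    (∀ i, 0 ≤ p i) ∧ ∑ i, p i = 1 ∧ (∀ i, W (y i) = X i * (X i)ᴴ) ∧ (∀ i, (B i).PosSemidef) ∧
    (t < 0 → ∀ i, (B i).PosDef) ∧ (∀ i, trp (B i) ((1 + t) / t) ≤ 1) ∧
    trp (∑ i, p i • (X i * B i * (X i)ᴴ)) ((1 + t) / (1 + 2 * t)) = κ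

/-- primal witness -/
def PrimalWit {Y : Type*} (t : ℝ) (W : Y → Matrix m m ℂ) (c : ℝ) : Prop :=
  ∃ σ : Matrix m m ℂ, σ.PosDef ∧ σ.trace = 1 ∧ ∀ y, t * sandwichTr t (W y) σ ≤ t * c

lemma dens_nonempty {ρ : Matrix m m ℂ} (h : IsDensity ρ) : Nonempty m := by
  by_contra hne
  rw [not_nonempty_iff] at hne
  have := h.2
  simp [Matrix.trace] at this

lemma exists_sigma [Nonempty m] : ∃ σ : Matrix m m ℂ, σ.PosDef ∧ σ.trace = 1 := by
  have hc : (0:ℝ) < Fintype.card m := by exact_mod_cast Fintype.card_pos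
  refine ⟨DD 1 (fun _ => 1 / (Fintype.card m : ℝ)), DD_pd isU_one fun i => by positivity, ?_⟩
  rw [DD_trace isU_one]
  simp

/-- uniform bound for a fixed distribution -/
lemma Q_bound {Y : Type*} [Fintype Y] {t : ℝ} (ht : Adm t) (W : Y → Matrix m m ℂ)
    (hW : ∀ y, IsDensity (W y)) (Q : Y → ℝ) (hQ : IsProbDist Q) :
    ∃ c : ℝ, 0 < c ∧ ∀ σ : Matrix m m ℂ, σ.PosDef → σ.trace = 1 →
      t * c ≤ t * ∑ y, Q y * sandwichTr t (W y) σ := by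
  have hY : Nonempty Y := by
    by_contra hne
    rw [not_nonempty_iff] at hne
    have := hQ.2
    simp at this
  have : Nonempty m := dens_nonempty (hW hY.some)
  choose X hX using fun y => exists_sqrt (hW y).1
  obtain ⟨β, hβ, hβ1, hβ2⟩ := exists_scalarB (m := m) ht
  refine ⟨(trp (∑ i, Q i • (X i * (β • (1 : Matrix m m ℂ)) * (X i)ᴴ)) ((1 + t) / (1 + 2 * t)))
    ^ (1 + 2 * t), ?_, fun σ hσ hσ1 => weak_duality ht Q W X (fun _ => β • 1) hQ.1 hQ.2 hX
      (fun _ => hβ2.posSemidef) (fun _ _ => hβ2) (fun _ => hβ1) hσ hσ1⟩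
  apply Real.rpow_pos_of_pos
  apply trp_pos
  · exact psd_sum_smul Q _ hQ.1 fun i => hβ2.posSemidef.mul_mul_conjTranspose_same _
  · rw [Matrix.trace_sum, Complex.re_sum]
    have : ∀ i, (Q i • (X i * (β • (1 : Matrix m m ℂ)) * (X i)ᴴ)).trace.re = Q i * β := by
      intro i
      rw [Matrix.mul_smul, Matrix.smul_mul, Matrix.mul_one, ← hX, Matrix.trace_smul,
        Matrix.trace_smul, (hW i).2]
      simp
    simp only [this]
    rw [← Finset.sum_mul, hQ.2, one_mul]
    exact hβ

lemma logb_mono_sign {t x y : ℝ} (ht0 : t ≠ 0) (hx : 0 < x) (hy : 0 < y) (h : t * x ≤ t * y) :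
    (1 / t) * Real.logb 2 x ≤ (1 / t) * Real.logb 2 y := by
  rcases lt_or_gt_of_ne ht0 with h0 | h0
  · apply mul_le_mul_of_nonpos_left _ (by rw [one_div]; exact (inv_lt_zero.2 h0).le)
    exact Real.logb_le_logb_of_le (by norm_num) hy (by nlinarith)
  · apply mul_le_mul_of_nonneg_left _ (by positivity)
    exact Real.logb_le_logb_of_le (by norm_num) hx (by nlinarith)

lemma sandwichTr_pos {t : ℝ} {W σ : Matrix m m ℂ} (hW : IsDensity W) (hσ : σ.PosDef) :
    0 < sandwichTr t W σ := by
  obtain ⟨X, hX⟩ := exists_sqrt hW.1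
  rw [sandwichTr_eq hX hσ]
  set S := σ.hpow (-(t / (1 + t))) with hS
  have hSpd : S.PosDef := hpow_pd hσ _
  apply trp_pos (hSpd.posSemidef.conjTranspose_mul_mul_same _)
  obtain ⟨V, s, hV, hs, hSe⟩ := exists_pd hSpd
  obtain ⟨U, a, hU, ha, hWe⟩ := exists_psd hW.1
  have e : (Xᴴ * S * X).trace.re = (W * S).trace.re := by
    rw [hX, Matrix.mul_assoc, Matrix.trace_mul_comm, Matrix.mul_assoc, Matrix.trace_mul_comm S]
  obtain ⟨w, hw, hr, hc, htr⟩ := exists_overlap hU hV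
  rw [e, hSe, hWe, htr]
  have h1 := hW.2
  rw [hWe, DD_trace hU] at h1
  have h2 : ∑ i, a i = 1 := by exact_mod_cast h1
  obtain ⟨i, -, hi⟩ := Finset.exists_lt_of_sum_lt (s := Finset.univ) (f := fun _ => (0:ℝ)) (g := a)
    (by simp [h2])
  obtain ⟨j, -, hj⟩ := Finset.exists_lt_of_sum_lt (s := Finset.univ) (f := fun _ => (0:ℝ)) (g := w i)
    (by simp [hr])
  have hnn : ∀ i j, 0 ≤ w i j * (a i * s j) := fun i j =>
    mul_nonneg (hw _ _) (mul_nonneg (ha i) (hs j).le)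
  apply Finset.sum_pos' (fun i _ => Finset.sum_nonneg fun j _ => hnn i j)
  refine ⟨i, Finset.mem_univ _, Finset.sum_pos' (fun j _ => hnn i j) ⟨j, Finset.mem_univ _, ?_⟩⟩
  exact mul_pos hj (mul_pos hi (hs j))

lemma Qsum_pos {Y : Type*} [Fintype Y] {t : ℝ} {W : Y → Matrix m m ℂ}
    (hW : ∀ y, IsDensity (W y)) {Q : Y → ℝ} (hQ : IsProbDist Q) {σ : Matrix m m ℂ}
    (hσ : σ.PosDef) : 0 < ∑ y, Q y * sandwichTr t (W y) σ := by
  obtain ⟨j, -, hj⟩ := Finset.exists_lt_of_sum_lt (s := Finset.univ) (f := fun _ => (0:ℝ)) (g := Q)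
    (by simp [hQ.2])
  exact Finset.sum_pos' (fun i _ => mul_nonneg (hQ.1 i) (sandwichTr_pos (hW i) hσ).le)
    ⟨j, Finset.mem_univ _, mul_pos hj (sandwichTr_pos (hW j) hσ)⟩

lemma Itilde_upper {Y : Type*} [Fintype Y] {t : ℝ} (ht : Adm t) {W : Y → Matrix m m ℂ}
    (hW : ∀ y, IsDensity (W y)) {Q : Y → ℝ} (hQ : IsProbDist Q) {c : ℝ} (hc : 0 < c)
    (h : PrimalWit t W c) : ItildeDown t W Q ≤ (1 / t) * Real.logb 2 c := by
  obtain ⟨σ, hσ, hσ1, hf⟩ := h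
  obtain ⟨c0, hc0, hb⟩ := Q_bound ht W hW Q hQ
  unfold ItildeDown
  refine (ciInf_le ⟨(1 / t) * Real.logb 2 c0, ?_⟩ ⟨σ, hσ, hσ1⟩).trans ?_
  · rintro _ ⟨τ, rfl⟩
    exact logb_mono_sign ht.2 hc0 (Qsum_pos hW hQ τ.2.1) (hb _ τ.2.1 τ.2.2)
  · apply logb_mono_sign ht.2 (Qsum_pos hW hQ hσ) hc
    have e : t * c = ∑ y, Q y * (t * c) := by rw [← Finset.sum_mul, hQ.2, one_mul]
    rw [e, Finset.mul_sum]
    apply Finset.sum_le_sum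
    intro y _
    calc _ = Q y * (t * sandwichTr t (W y) σ) := by ring
      _ ≤ _ := mul_le_mul_of_nonneg_left (hf y) (hQ.1 y)

lemma Itilde_lower {Y : Type*} [Fintype Y] {t : ℝ} (ht : Adm t) {W : Y → Matrix m m ℂ}
    (hW : ∀ y, IsDensity (W y)) {κ : ℝ} (hκ : 0 < κ) (h : DualWit t W κ) :
    ∃ Q : Y → ℝ, IsProbDist Q ∧ (1 / t) * Real.logb 2 (κ ^ (1 + 2 * t)) ≤ ItildeDown t W Q := by
  classical
  obtain ⟨ι, _, p, y, X, B, hp, hp1, hX, hB, hB', hBt, hK⟩ := h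
  have hsum : ∀ g : Y → ℝ, ∑ z, (∑ i, if y i = z then p i else 0) * g z = ∑ i, p i * g (y i) := by
    intro g
    simp only [Finset.sum_mul]
    rw [Finset.sum_comm]
    simp
  have hQ : IsProbDist (fun z => ∑ i, if y i = z then p i else 0) := by
    refine ⟨fun z => Finset.sum_nonneg fun i _ => by split_ifs; exacts [hp i, le_rfl], ?_⟩
    have := hsum (fun _ => 1)
    simpa [hp1] using this
  have hne : Nonempty Y := by
    by_contra hne
    rw [not_nonempty_iff] at hne
    have := hQ.2
    simp at this
  have : Nonempty m := dens_nonempty (hW hne.some)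
  obtain ⟨σ0, h0, h01⟩ := exists_sigma (m := m)
  have : Nonempty {σ : Matrix m m ℂ // σ.PosDef ∧ σ.trace = 1} := ⟨⟨σ0, h0, h01⟩⟩
  refine ⟨_, hQ, ?_⟩
  unfold ItildeDown
  apply le_ciInf
  intro σ
  apply logb_mono_sign ht.2 (Real.rpow_pos_of_pos hκ _) (Qsum_pos hW hQ σ.2.1)
  rw [hsum, ← hK]
  exact weak_duality ht p (fun i => W (y i)) X B hp hp1 hX hB hB' hBt σ.2.1 σ.2.2

/-- weak duality for witnesses -/
lemma wit_le {Y : Type*} {t : ℝ} (ht : Adm t) {W : Y → Matrix m m ℂ} {κ c : ℝ}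
    (h : DualWit t W κ) (h' : PrimalWit t W c) : t * κ ^ (1 + 2 * t) ≤ t * c := by
  obtain ⟨ι, _, p, y, X, B, hp, hp1, hX, hB, hB', hBt, rfl⟩ := h
  obtain ⟨σ, hσ, hσ1, hf⟩ := h'
  refine (weak_duality ht p (fun i => W (y i)) X B hp hp1 hX hB hB' hBt hσ hσ1).trans ?_
  have e : t * c = ∑ y, p y * (t * c) := by rw [← Finset.sum_mul, hp1, one_mul]
  rw [e, Finset.mul_sum]
  apply Finset.sum_le_sum
  intro i _
  calc _ = p i * (t * sandwichTr t (W (y i)) σ) := by ring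
    _ ≤ _ := mul_le_mul_of_nonneg_left (hf (y i)) (hp i)

end weak


/-- tensor product of a finite family of matrices -/
def tens {m : Type*} {n : ℕ} (A : Fin n → Matrix m m ℂ) : Matrix (Fin n → m) (Fin n → m) ℂ :=
  Matrix.of fun i j => ∏ k, A k (i k) (j k)

section tensor
variable {m : Type*} [Fintype m] [DecidableEq m] {n : ℕ}

lemma tens_mul (A B : Fin n → Matrix m m ℂ) : tens A * tens B = tens (fun k => A k * B k) := by
  ext i j
  simp only [tens, Matrix.mul_apply, Matrix.of_apply]
  rw [Fintype.prod_sum]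
  simp only [Finset.prod_mul_distrib]

lemma tens_conjTranspose (A : Fin n → Matrix m m ℂ) : (tens A)ᴴ = tens (fun k => (A k)ᴴ) := by
  ext i j
  simp [tens, Matrix.conjTranspose_apply]

lemma tens_diagonal (a : Fin n → m → ℂ) :
    tens (fun k => diagonal (a k)) = diagonal (fun i => ∏ k, a k (i k)) := by
  ext i j
  simp only [tens, Matrix.of_apply]
  by_cases h : i = j
  · subst h; simp
  · rw [diagonal_apply_ne _ h]
    obtain ⟨k, hk⟩ := Function.ne_iff.1 h
    exact Finset.prod_eq_zero (Finset.mem_univ k) (diagonal_apply_ne _ hk)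

lemma tens_one : tens (fun _ : Fin n => (1 : Matrix m m ℂ)) = 1 := by
  have := tens_diagonal (m := m) (n := n) (fun _ _ => 1)
  simpa using this

lemma tens_isU {U : Fin n → Matrix m m ℂ} (hU : ∀ k, IsU (U k)) : IsU (tens U) := by
  constructor
  · rw [tens_conjTranspose, tens_mul]
    simp only [(hU _).1, tens_one]
  · rw [tens_conjTranspose, tens_mul]
    simp only [(hU _).2, tens_one]

lemma tens_DD (U : Fin n → Matrix m m ℂ) (a : Fin n → m → ℝ) :
    tens (fun k => DD (U k) (a k)) = DD (tens U) (fun i => ∏ k, a k (i k)) := by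
  unfold DD
  rw [← tens_mul, ← tens_mul, tens_conjTranspose, tens_diagonal]
  simp

lemma tens_trace (A : Fin n → Matrix m m ℂ) : (tens A).trace = ∏ k, (A k).trace := by
  simp only [Matrix.trace, tens, Matrix.diag_apply, Matrix.of_apply]
  rw [Fintype.prod_sum]

lemma tens_psd {A : Fin n → Matrix m m ℂ} (hA : ∀ k, (A k).PosSemidef) : (tens A).PosSemidef := by
  choose U a hU ha hAe using fun k => exists_psd (hA k)
  rw [funext hAe, tens_DD]
  exact DD_psd fun i => Finset.prod_nonneg fun k _ => ha k _

lemma tens_pd {A : Fin n → Matrix m m ℂ} (hA : ∀ k, (A k).PosDef) : (tens A).PosDef := by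
  choose U a hU ha hAe using fun k => exists_pd (hA k)
  rw [funext hAe, tens_DD]
  exact DD_pd (tens_isU hU) fun i => Finset.prod_pos fun k _ => ha k _

lemma tens_hpow {A : Fin n → Matrix m m ℂ} (hA : ∀ k, (A k).PosSemidef) (r : ℝ) :
    (tens A).hpow r = tens (fun k => (A k).hpow r) := by
  choose U a hU ha hAe using fun k => exists_psd (hA k)
  rw [funext hAe, tens_DD, hpow_DD (tens_isU hU)]
  simp only [hpow_DD (hU _)]
  rw [tens_DD]
  congr 1
  ext i
  exact (Real.finsetProd_rpow _ _ (fun k _ => ha k _) r).symm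

lemma tens_trp {A : Fin n → Matrix m m ℂ} (hA : ∀ k, (A k).PosSemidef) (r : ℝ) :
    trp (tens A) r = ∏ k, trp (A k) r := by
  choose U a hU ha hAe using fun k => exists_psd (hA k)
  rw [funext hAe, tens_DD, trp_DD (tens_isU hU)]
  simp only [trp_DD (hU _)]
  rw [Fintype.prod_sum]
  apply Finset.sum_congr rfl
  intro i _
  exact (Real.finsetProd_rpow _ _ (fun k _ => ha k _) r).symm

lemma tens_sum {ι : Type*} [Fintype ι] (p : ι → ℝ) (Z : ι → Matrix m m ℂ) :
    tens (fun _ : Fin n => ∑ i, p i • Z i) = ∑ i : Fin n → ι, (∏ k, p (i k)) • tens (fun k => Z (i k)) := by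
  ext a b
  simp only [tens, Matrix.of_apply, Matrix.sum_apply, Matrix.smul_apply]
  rw [Fintype.prod_sum]
  apply Finset.sum_congr rfl
  intro i _
  simp [Finset.prod_mul_distrib]

lemma tens_sandwich {W : Fin n → Matrix m m ℂ} (hW : ∀ k, (W k).PosSemidef) {σ : Matrix m m ℂ}
    (hσ : σ.PosDef) (t : ℝ) :
    sandwichTr t (tens W) (tens (fun _ => σ)) = ∏ k, sandwichTr t (W k) σ := by
  choose X hX using fun k => exists_sqrt (hW k)
  have h1 : tens W = tens X * (tens X)ᴴ := by
    rw [tens_conjTranspose, tens_mul]; congr 1; ext1 k; exact hX k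
  rw [sandwichTr_eq h1 (tens_pd fun _ => hσ)]
  simp only [fun k => sandwichTr_eq (t := t) (hX k) hσ]
  rw [tens_hpow (fun _ => hσ.posSemidef), tens_conjTranspose, tens_mul, tens_mul, tens_trp]
  intro k
  exact (hpow_pd hσ _).posSemidef.conjTranspose_mul_mul_same _

lemma dual_tensor {Y : Type*} {d : ℕ} {t : ℝ} {W : Y → Matrix (Fin d) (Fin d) ℂ} {κ : ℝ}
    (h : DualWit t W κ) (n : ℕ) : DualWit t (prodChannel W n) (κ ^ n) := by
  obtain ⟨ι, _, p, y, X, B, hp, hp1, hX, hB, hB', hBt, hK⟩ := h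
  refine ⟨Fin n → ι, inferInstance, fun i => ∏ k, p (i k), fun i k => y (i k),
    fun i => tens (fun k => X (i k)), fun i => tens (fun k => B (i k)), ?_, ?_, ?_, ?_, ?_, ?_, ?_⟩
  · exact fun i => Finset.prod_nonneg fun k _ => hp _
  · rw [← Fintype.prod_sum]; simp [hp1]
  · intro i
    rw [tens_conjTranspose, tens_mul]
    simp only [← hX]
    rfl
  · exact fun i => tens_psd fun k => hB _
  · exact fun h i => tens_pd fun k => hB' h _
  · intro i
    rw [tens_trp (fun k => hB _)]
    exact Finset.prod_le_one (fun k _ => trp_nonneg (hB _) _) (fun k _ => hBt _)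
  · have e : ∀ i : Fin n → ι, tens (fun k => X (i k)) * tens (fun k => B (i k)) *
        (tens (fun k => X (i k)))ᴴ = tens (fun k => X (i k) * B (i k) * (X (i k))ᴴ) := by
      intro i
      rw [tens_conjTranspose, tens_mul, tens_mul]
    simp only [e]
    rw [← tens_sum p (fun i => X i * B i * (X i)ᴴ), tens_trp, hK]
    · simp
    · exact fun k => psd_sum_smul p _ hp fun i => (hB i).mul_mul_conjTranspose_same _

lemma primal_tensor {Y : Type*} {d : ℕ} {t : ℝ} {W : Y → Matrix (Fin d) (Fin d) ℂ} {c : ℝ}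
    (ht0 : t ≠ 0) (hc : 0 < c)
    (hW : ∀ y, IsDensity (W y)) (h : PrimalWit t W c) (n : ℕ) :
    PrimalWit t (prodChannel W n) (c ^ n) := by
  obtain ⟨σ, hσ, hσ1, hf⟩ := h
  refine ⟨tens (fun _ => σ), tens_pd fun _ => hσ, ?_, ?_⟩
  · rw [tens_trace]; simp [hσ1]
  intro y
  change t * sandwichTr t (tens (fun k => W (y k))) _ ≤ _
  rw [tens_sandwich (fun k => (hW _).1) hσ]
  rcases lt_or_gt_of_ne ht0 with h | h
  · apply mul_le_mul_of_nonpos_left _ h.le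
    calc c ^ n = ∏ k : Fin n, c := by simp
      _ ≤ _ := Finset.prod_le_prod (fun _ _ => hc.le) fun k _ => by
        have := hf (y k); nlinarith
  · apply mul_le_mul_of_nonneg_left _ h.le
    calc _ ≤ ∏ k : Fin n, c := Finset.prod_le_prod (fun k _ => (sandwichTr_pos (hW _) hσ).le)
          fun k _ => by have := hf (y k); nlinarith
      _ = _ := by simp

lemma prod_density {Y : Type*} {d : ℕ} {W : Y → Matrix (Fin d) (Fin d) ℂ}
    (hW : ∀ y, IsDensity (W y)) (n : ℕ) (y : Fin n → Y) : IsDensity (prodChannel W n y) := by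
  change IsDensity (tens (fun k => W (y k)))
  refine ⟨tens_psd fun k => (hW _).1, ?_⟩
  rw [tens_trace]
  simp [(hW _).2]

end tensor

/-- final assembly from strong duality -/
lemma sup_eq {m : Type*} [Fintype m] [DecidableEq m] {Y : Type*} [Fintype Y] [Nonempty Y] {t : ℝ}
    (ht : Adm t) {W : Y → Matrix m m ℂ} (hW : ∀ y, IsDensity (W y)) (L : ℝ)
    (hP : ∀ δ > 0, ∃ c > 0, (1 / t) * Real.logb 2 c ≤ L + δ ∧ PrimalWit t W c)
    (hD : ∀ δ > 0, ∃ κ > 0, L - δ ≤ (1 / t) * Real.logb 2 (κ ^ (1 + 2 * t)) ∧ DualWit t W κ) :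
    (⨆ Q : {Q : Y → ℝ // IsProbDist Q}, ItildeDown t W Q.1) = L := by
  classical
  have hub : ∀ Q : {Q : Y → ℝ // IsProbDist Q}, ItildeDown t W Q.1 ≤ L := by
    intro Q
    apply le_of_forall_pos_le_add
    intro δ hδ
    obtain ⟨c, hc, h1, h2⟩ := hP δ hδ
    exact (Itilde_upper ht hW Q.2 hc h2).trans h1
  have : Nonempty {Q : Y → ℝ // IsProbDist Q} := by
    obtain ⟨κ, hκ, -, h2⟩ := hD 1 one_pos
    obtain ⟨Q, hQ, -⟩ := Itilde_lower ht hW hκ h2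
    exact ⟨⟨Q, hQ⟩⟩
  apply le_antisymm (ciSup_le hub)
  apply le_of_forall_pos_le_add
  intro δ hδ
  obtain ⟨κ, hκ, h1, h2⟩ := hD δ hδ
  obtain ⟨Q, hQ, h3⟩ := Itilde_lower ht hW hκ h2
  have := le_ciSup (f := fun Q : {Q : Y → ℝ // IsProbDist Q} => ItildeDown t W Q.1)
    ⟨L, by rintro _ ⟨Q, rfl⟩; exact hub Q⟩ ⟨Q, hQ⟩
  simp only at this
  linarith


set_option linter.unusedSectionVars false

lemma rpow_lip (r ε M : ℝ) (hε : 0 < ε) : ∃ L ≥ 0, ∀ x ∈ Set.Icc ε M, ∀ y ∈ Set.Icc ε M,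
    |x ^ r - y ^ r| ≤ L * |x - y| := by
  have hcont : ContinuousOn (fun x : ℝ => r * x ^ (r - 1)) (Set.Icc ε M) := by
    apply ContinuousOn.mul continuousOn_const
    apply ContinuousOn.rpow_const continuousOn_id
    intro x hx
    exact Or.inl (by have := hx.1; simp only [id]; linarith)
  obtain ⟨L, hL⟩ := isCompact_Icc.exists_bound_of_continuousOn hcont
  refine ⟨max L 0, le_max_right _ _, fun x hx y hy => ?_⟩
  have := (convex_Icc ε M).norm_image_sub_le_of_norm_hasDerivWithin_le
    (f := fun x : ℝ => x ^ r) (f' := fun x => r * x ^ (r - 1)) (C := max L 0)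
    (fun z hz => (Real.hasDerivAt_rpow_const (Or.inl (by have := hz.1; linarith))).hasDerivWithinAt)
    (fun z hz => (hL z hz).trans (le_max_left _ _)) hy hx
  simpa [Real.norm_eq_abs] using this

lemma taylor2 (p ε M : ℝ) (hε : 0 < ε) : ∃ C ≥ 0, ∀ a ∈ Set.Icc ε M, ∀ b ∈ Set.Icc ε M,
    |b ^ p - a ^ p - p * a ^ (p - 1) * (b - a)| ≤ C * (b - a) ^ 2 := by
  obtain ⟨L, hL0, hL⟩ := rpow_lip (p - 1) ε M hε
  refine ⟨|p| * L, by positivity, fun a ha b hb => ?_⟩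
  have hsub : Set.uIcc a b ⊆ Set.Icc ε M := Set.uIcc_subset_Icc ha hb
  have := (convex_uIcc a b).norm_image_sub_le_of_norm_hasDerivWithin_le
    (f := fun x : ℝ => x ^ p - p * a ^ (p - 1) * x)
    (f' := fun x => p * x ^ (p - 1) - p * a ^ (p - 1) * 1) (C := |p| * L * |b - a|)
    (fun z hz => (((Real.hasDerivAt_rpow_const (Or.inl (by have := (hsub hz).1; linarith))).sub
      ((hasDerivAt_id z).const_mul _)).hasDerivWithinAt))
    (fun z hz => by
      rw [Real.norm_eq_abs]
      have e : p * z ^ (p - 1) - p * a ^ (p - 1) * 1 = p * (z ^ (p - 1) - a ^ (p - 1)) := by ring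
      rw [e, abs_mul, mul_assoc]
      apply mul_le_mul_of_nonneg_left _ (abs_nonneg _)
      refine (hL z (hsub hz) a ha).trans (mul_le_mul_of_nonneg_left ?_ hL0)
      exact Set.abs_sub_left_of_mem_uIcc hz)
    Set.left_mem_uIcc Set.right_mem_uIcc
  rw [Real.norm_eq_abs, Real.norm_eq_abs] at this
  calc _ = |b ^ p - p * a ^ (p - 1) * b - (a ^ p - p * a ^ (p - 1) * a)| := by
        congr 1; ring
    _ ≤ _ := this
    _ = _ := by rw [mul_assoc, ← sq, sq_abs]

section nearopt
variable {m : Type*} [Fintype m] [DecidableEq m]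

lemma mat_taylor (p ε M : ℝ) (hε : 0 < ε) : ∃ C ≥ 0, ∀ (U V : Matrix m m ℂ) (a b : m → ℝ),
    IsU U → IsU V → (∀ i, a i ∈ Set.Icc ε M) → (∀ i, b i ∈ Set.Icc ε M) →
    |trp (DD V b) p - trp (DD U a) p -
      p * ((DD U a).hpow (p - 1) * (DD V b - DD U a)).trace.re|
      ≤ C * ((DD V b - DD U a) * (DD V b - DD U a)).trace.re := by
  obtain ⟨C, hC, h⟩ := taylor2 p ε M hε
  refine ⟨C, hC, fun U V a b hU hV ha hb => ?_⟩
  obtain ⟨w, hw, hr, hc, ht⟩ := exists_overlap hU hV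
  have hsa : ∀ x : m → ℝ, ∑ i, x i = ∑ i, ∑ j, w i j * x i := fun x => by
    simp only [← Finset.sum_mul, hr, one_mul]
  have hsb : ∀ x : m → ℝ, ∑ i, x i = ∑ i, ∑ j, w i j * x j := fun x => by
    rw [Finset.sum_comm]
    simp only [← Finset.sum_mul, hc, one_mul]
  have e1 : ((DD U a).hpow (p - 1) * (DD V b - DD U a)).trace.re
      = ∑ i, ∑ j, w i j * (a i ^ (p - 1) * (b j - a i)) := by
    rw [Matrix.mul_sub, Matrix.trace_sub, Complex.sub_re, hpow_DD hU, ht, DD_mul hU, DD_trace hU,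
      Complex.ofReal_re, hsa (fun i => a i ^ (p - 1) * a i), ← Finset.sum_sub_distrib]
    apply Finset.sum_congr rfl; intro i _
    rw [← Finset.sum_sub_distrib]
    apply Finset.sum_congr rfl; intro j _
    ring
  have e2 : ((DD V b - DD U a) * (DD V b - DD U a)).trace.re
      = ∑ i, ∑ j, w i j * (b j - a i) ^ 2 := by
    rw [Matrix.mul_sub, Matrix.sub_mul, Matrix.sub_mul, Matrix.trace_sub, Matrix.trace_sub,
      Matrix.trace_sub, Matrix.trace_mul_comm (DD V b) (DD U a), Complex.sub_re, Complex.sub_re,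
      Complex.sub_re, ht, DD_mul hU, DD_mul hV, DD_trace hU, DD_trace hV,
      Complex.ofReal_re, Complex.ofReal_re, hsa (fun i => a i * a i), hsb (fun i => b i * b i), ← Finset.sum_sub_distrib,
      ← Finset.sum_sub_distrib, ← Finset.sum_sub_distrib]
    apply Finset.sum_congr rfl; intro i _
    rw [← Finset.sum_sub_distrib, ← Finset.sum_sub_distrib, ← Finset.sum_sub_distrib]
    apply Finset.sum_congr rfl; intro j _
    ring
  rw [e1, e2, trp_DD hU, trp_DD hV, hsa (fun i => a i ^ p), hsb (fun i => b i ^ p), Finset.mul_sum, Finset.mul_sum,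
    ← Finset.sum_sub_distrib, ← Finset.sum_sub_distrib]
  refine (Finset.abs_sum_le_sum_abs _ _).trans (Finset.sum_le_sum fun i _ => ?_)
  rw [Finset.mul_sum, Finset.mul_sum, ← Finset.sum_sub_distrib, ← Finset.sum_sub_distrib]
  refine (Finset.abs_sum_le_sum_abs _ _).trans (Finset.sum_le_sum fun j _ => ?_)
  have e3 : w i j * b j ^ p - w i j * a i ^ p - p * (w i j * (a i ^ (p - 1) * (b j - a i)))
      = w i j * (b j ^ p - a i ^ p - p * a i ^ (p - 1) * (b j - a i)) := by ring
  rw [e3, abs_mul, abs_of_nonneg (hw i j)]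
  calc _ ≤ w i j * (C * (b j - a i) ^ 2) :=
        mul_le_mul_of_nonneg_left (h _ (ha i) _ (hb j)) (hw i j)
    _ = _ := by ring

/-- spectral form of `K + ε` -/
lemma shift_spec {K : Matrix m m ℂ} (hK : K.PosSemidef) {M ε : ℝ} (hM : K.trace.re ≤ M) :
    ∃ U a, IsU U ∧ (∀ i, 0 ≤ a i) ∧ (∀ i, a i ≤ M) ∧ K = DD U a ∧
      K + ε • (1 : Matrix m m ℂ) = DD U (fun i => a i + ε) := by
  obtain ⟨U, a, hU, ha, rfl⟩ := exists_psd hK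
  refine ⟨U, a, hU, ha, fun i => ?_, rfl, ?_⟩
  · rw [DD_trace hU, Complex.ofReal_re] at hM
    exact (Finset.single_le_sum (fun i _ => ha i) (Finset.mem_univ i)).trans hM
  · rw [← DD_const hU, DD_add]

lemma trace_sq_le {K : Matrix m m ℂ} (hK : K.PosSemidef) {M : ℝ} (hM : K.trace.re ≤ M) :
    (K * K).trace.re ≤ M ^ 2 := by
  obtain ⟨U, a, hU, ha, haM, rfl, -⟩ := shift_spec (ε := 0) hK hM
  have h1 := trace_mul_le hK hU haM
  rw [DD_trace hU, Complex.ofReal_re] at *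
  have h0 : 0 ≤ ∑ i, a i := Finset.sum_nonneg fun i _ => ha i
  nlinarith

lemma near_opt (𝒦 : Set (Matrix m m ℂ)) (hconv : Convex ℝ 𝒦) (hne : 𝒦.Nonempty) (M : ℝ)
    (h𝒦 : ∀ K ∈ 𝒦, K.PosSemidef ∧ K.trace.re ≤ M) (c : ℝ) (hc : |c| = 1) (p : ℝ) {ε η : ℝ}
    (hε : 0 < ε) (hη : 0 < η) :
    ∃ K ∈ 𝒦, ∀ K' ∈ 𝒦,
      c * (p * ((K + ε • (1 : Matrix m m ℂ)).hpow (p - 1) * (K' - K)).trace.re) ≤ η := by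
  obtain ⟨C, hC, hT⟩ := mat_taylor (m := m) p ε (M + ε) hε
  set φ : Matrix m m ℂ → ℝ := fun K => c * trp (K + ε • (1 : Matrix m m ℂ)) p with hφ
  -- boundedness
  have hbdd : BddAbove (φ '' 𝒦) := by
    have hcont : ContinuousOn (fun x : ℝ => x ^ p) (Set.Icc ε (M + ε)) := by
      apply ContinuousOn.rpow_const continuousOn_id
      intro x hx
      exact Or.inl (by have := hx.1; simp only [id]; linarith)
    obtain ⟨R, hR⟩ := isCompact_Icc.exists_bound_of_continuousOn hcont
    refine ⟨∑ _i : m, R, ?_⟩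
    rintro _ ⟨K, hK, rfl⟩
    obtain ⟨U, a, hU, ha, haM, -, hs⟩ := shift_spec (ε := ε) (h𝒦 K hK).1 (h𝒦 K hK).2
    simp only [hφ, hs, trp_DD hU]
    refine (le_abs_self _).trans ?_
    rw [abs_mul, hc, one_mul]
    refine (Finset.abs_sum_le_sum_abs _ _).trans (Finset.sum_le_sum fun i _ => ?_)
    exact hR _ ⟨by linarith [ha i], by linarith [haM i]⟩
  -- choose step
  set E := C * (2 * M ^ 2) with hE
  have hE0 : 0 ≤ E := by positivity
  obtain ⟨l, hl0, hl1, hlE⟩ : ∃ l : ℝ, 0 < l ∧ l ≤ 1 ∧ E * l ≤ η / 2 := by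
    refine ⟨min 1 (η / 2 / (E + 1)), by positivity, min_le_left _ _, ?_⟩
    calc E * min 1 (η / 2 / (E + 1)) ≤ (E + 1) * (η / 2 / (E + 1)) :=
          mul_le_mul (by linarith) (min_le_right _ _) (by positivity) (by linarith)
      _ = η / 2 := by field_simp
  obtain ⟨_, ⟨K, hK, rfl⟩, hnear⟩ := exists_lt_of_lt_csSup (hne.image φ)
    (show sSup (φ '' 𝒦) - l * η / 2 < sSup (φ '' 𝒦) by
      have : 0 < l * η / 2 := by positivity
      linarith)
  refine ⟨K, hK, fun K' hK' => ?_⟩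
  set L := K + l • (K' - K) with hL
  have hLmem : L ∈ 𝒦 := hconv.add_smul_sub_mem hK hK' ⟨hl0.le, hl1⟩
  have h1 : φ L ≤ φ K + l * η / 2 := by
    have := le_csSup hbdd ⟨L, hLmem, rfl⟩
    linarith
  obtain ⟨U, a, hU, ha, haM, -, hs⟩ := shift_spec (ε := ε) (h𝒦 K hK).1 (h𝒦 K hK).2
  obtain ⟨V, b, hV, hb, hbM, -, hs'⟩ := shift_spec (ε := ε) (h𝒦 L hLmem).1 (h𝒦 L hLmem).2
  have h2 := hT U V (fun i => a i + ε) (fun i => b i + ε) hU hV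
    (fun i => ⟨by show ε ≤ a i + ε; linarith [ha i], by show a i + ε ≤ M + ε; linarith [haM i]⟩)
    (fun i => ⟨by show ε ≤ b i + ε; linarith [hb i], by show b i + ε ≤ M + ε; linarith [hbM i]⟩)
  rw [← hs, ← hs'] at h2
  have hd : L + ε • (1 : Matrix m m ℂ) - (K + ε • (1 : Matrix m m ℂ)) = l • (K' - K) := by
    rw [hL]; abel
  rw [hd] at h2
  have hsq : ((l • (K' - K)) * (l • (K' - K))).trace.re ≤ l ^ 2 * (2 * M ^ 2) := by
    rw [Matrix.smul_mul, Matrix.mul_smul, smul_smul, Matrix.trace_smul, Complex.smul_re,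
      smul_eq_mul, ← sq]
    apply mul_le_mul_of_nonneg_left _ (by positivity)
    rw [Matrix.mul_sub, Matrix.sub_mul, Matrix.sub_mul, Matrix.trace_sub, Matrix.trace_sub,
      Matrix.trace_sub, Complex.sub_re, Complex.sub_re, Complex.sub_re]
    have := trace_sq_le (h𝒦 K hK).1 (h𝒦 K hK).2
    have := trace_sq_le (h𝒦 K' hK').1 (h𝒦 K' hK').2
    have := trace_mul_nonneg (h𝒦 K hK).1 (h𝒦 K' hK').1
    have := trace_mul_nonneg (h𝒦 K' hK').1 (h𝒦 K hK).1
    linarith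
  rw [Matrix.mul_smul, Matrix.trace_smul, Complex.smul_re, smul_eq_mul] at h2
  set T := ((K + ε • (1 : Matrix m m ℂ)).hpow (p - 1) * (K' - K)).trace.re with hTdef
  have h3 : |c * (trp (L + ε • (1 : Matrix m m ℂ)) p - trp (K + ε • (1 : Matrix m m ℂ)) p
      - p * (l * T))| ≤ E * l ^ 2 := by
    rw [abs_mul, hc, one_mul]
    refine h2.trans ((mul_le_mul_of_nonneg_left hsq hC).trans (le_of_eq ?_))
    rw [hE]; ring
  have h4 := (abs_le.1 h3).1
  simp only [hφ] at h1
  have h5 : l * (c * (p * T)) ≤ l * η := by nlinarith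
  exact le_of_mul_le_mul_left h5 hl0

end nearopt


section opt
variable {m : Type*} [Fintype m] [DecidableEq m]

lemma opt_pos {t : ℝ} (ht : 0 < t) {A : Matrix m m ℂ} (hA : A.PosSemidef)
    (hT : 0 < trp A (1 + t)) : ∃ B : Matrix m m ℂ, B.PosSemidef ∧ trp B ((1 + t) / t) ≤ 1 ∧
      ((A * B).trace.re) ^ (1 + t) = trp A (1 + t) := by
  obtain ⟨U, a, hU, ha, rfl⟩ := exists_psd hA
  rw [trp_DD hU] at hT ⊢
  set T := ∑ i, a i ^ (1 + t) with hTd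
  have h1t : 0 < 1 + t := by linarith
  have hB : ∀ i, 0 ≤ a i ^ t * T ^ (-(t / (1 + t))) := fun i =>
    mul_nonneg (Real.rpow_nonneg (ha i) _) (Real.rpow_nonneg hT.le _)
  refine ⟨DD U (fun i => a i ^ t * T ^ (-(t / (1 + t)))), DD_psd hB, ?_, ?_⟩
  · rw [trp_DD hU]
    have : ∀ i, (a i ^ t * T ^ (-(t / (1 + t)))) ^ ((1 + t) / t) = a i ^ (1 + t) * T⁻¹ := by
      intro i
      rw [Real.mul_rpow (Real.rpow_nonneg (ha i) _) (Real.rpow_nonneg hT.le _),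
        ← Real.rpow_mul (ha i), ← Real.rpow_mul hT.le, ← Real.rpow_neg_one]
      congr 2 <;> field_simp
    simp only [this, ← Finset.sum_mul]
    rw [← hTd, mul_inv_cancel₀ hT.ne']
  · rw [DD_mul hU, DD_trace hU, Complex.ofReal_re]
    have : ∀ i, a i * (a i ^ t * T ^ (-(t / (1 + t)))) = a i ^ (1 + t) * T ^ (-(t / (1 + t))) := by
      intro i
      rw [← mul_assoc, Real.rpow_add' (ha i) (by linarith), Real.rpow_one]
    simp only [this, ← Finset.sum_mul]
    rw [← hTd]
    nth_rewrite 1 [← Real.rpow_one T]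
    rw [← Real.rpow_add hT, ← Real.rpow_mul hT.le]
    rw [show (1 + -(t / (1 + t))) * (1 + t) = 1 by field_simp; ring, Real.rpow_one]

lemma opt_neg [Nonempty m] {t : ℝ} (ht : Adm t) (ht0 : t < 0) {η : ℝ} (hη : 0 < η) :
    ∃ M : ℝ, ∀ A : Matrix m m ℂ, A.PosSemidef → A.trace.re ≤ 1 → ∃ B : Matrix m m ℂ, B.PosDef ∧
      trp B ((1 + t) / t) ≤ 1 ∧ (∃ V b, IsU V ∧ B = DD V b ∧ ∀ i, b i ≤ M) ∧
      0 ≤ (A * B).trace.re ∧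
      ((A * B).trace.re) ^ (1 + t) ≤ trp A (1 + t) + Fintype.card m * η ^ (1 + t) := by
  have h1t : 0 < 1 + t := by have := ht.1; linarith
  refine ⟨η ^ t * (Fintype.card m * (1 + η) ^ (1 + t)) ^ (-(t / (1 + t))), fun A hA hA1 => ?_⟩
  obtain ⟨U, a, hU, ha, ha1, rfl, -⟩ := shift_spec (ε := 0) hA hA1
  have hp : ∀ i, 0 < a i + η := fun i => by linarith [ha i]
  set T := ∑ i, (a i + η) ^ (1 + t) with hTd
  have hT : 0 < T := Finset.sum_pos (fun i _ => Real.rpow_pos_of_pos (hp i) _)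
    Finset.univ_nonempty
  have hT1 : T ≤ Fintype.card m * (1 + η) ^ (1 + t) := by
    calc T ≤ ∑ _i : m, (1 + η) ^ (1 + t) := Finset.sum_le_sum fun i _ =>
          Real.rpow_le_rpow (hp i).le (by linarith [ha1 i]) h1t.le
      _ = _ := by simp
  have hs : 0 ≤ -(t / (1 + t)) := by
    rw [← neg_div]; exact div_nonneg (by linarith) h1t.le
  have hTp : 0 < T ^ (-(t / (1 + t))) := Real.rpow_pos_of_pos hT _
  have hb : ∀ i, 0 < (a i + η) ^ t * T ^ (-(t / (1 + t))) := fun i =>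
    mul_pos (Real.rpow_pos_of_pos (hp i) _) hTp
  have hBpd := DD_pd hU hb
  refine ⟨DD U (fun i => (a i + η) ^ t * T ^ (-(t / (1 + t)))), hBpd, ?_, ⟨U, _, hU, rfl, ?_⟩,
    trace_mul_nonneg hA hBpd.posSemidef, ?_⟩
  · rw [trp_DD hU]
    have : ∀ i, ((a i + η) ^ t * T ^ (-(t / (1 + t)))) ^ ((1 + t) / t)
        = (a i + η) ^ (1 + t) * T⁻¹ := by
      intro i
      rw [Real.mul_rpow (Real.rpow_nonneg (hp i).le _) hTp.le,
        ← Real.rpow_mul (hp i).le, ← Real.rpow_mul hT.le, ← Real.rpow_neg_one]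
      have := ht0.ne
      congr 2 <;> field_simp
    simp only [this, ← Finset.sum_mul]
    rw [← hTd, mul_inv_cancel₀ hT.ne']
  · intro i
    apply mul_le_mul _ (Real.rpow_le_rpow hT.le hT1 hs) hTp.le (Real.rpow_nonneg hη.le _)
    exact Real.rpow_le_rpow_of_nonpos hη (by linarith [ha i]) ht0.le
  · have hle : (DD U a * DD U (fun i => (a i + η) ^ t * T ^ (-(t / (1 + t))))).trace.re
        ≤ T ^ (1 / (1 + t)) := by
      rw [DD_mul hU, DD_trace hU, Complex.ofReal_re]
      calc ∑ i, a i * ((a i + η) ^ t * T ^ (-(t / (1 + t))))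
          ≤ ∑ i, (a i + η) ^ (1 + t) * T ^ (-(t / (1 + t))) := by
            apply Finset.sum_le_sum; intro i _
            rw [Real.rpow_add (hp i), Real.rpow_one, mul_assoc]
            exact mul_le_mul_of_nonneg_right (by linarith) (hb i).le
        _ = T ^ (1 / (1 + t)) := by
            rw [← Finset.sum_mul, ← hTd]
            nth_rewrite 1 [← Real.rpow_one T]
            rw [← Real.rpow_add hT]
            congr 1
            field_simp
            ring
    refine (Real.rpow_le_rpow (trace_mul_nonneg hA hBpd.posSemidef) hle h1t.le).trans ?_
    rw [← Real.rpow_mul hT.le, one_div_mul_cancel h1t.ne', Real.rpow_one, trp_DD hU]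
    calc T ≤ ∑ i, (a i ^ (1 + t) + η ^ (1 + t)) := Finset.sum_le_sum fun i _ =>
          Real.rpow_add_le_add_rpow (ha i) hη.le h1t.le (by linarith)
      _ = _ := by rw [Finset.sum_add_distrib]; simp

/-- the near-optimal state built from `A` -/
lemma sigma_of [Nonempty m] {t : ℝ} (ht : Adm t) {A : Matrix m m ℂ} (hA : A.PosDef) :
    0 < trp A ((1 + t) / (1 + 2 * t)) ∧ ∃ σ : Matrix m m ℂ, σ.PosDef ∧ σ.trace = 1 ∧
      σ.hpow (-(t / (1 + t))) = (trp A ((1 + t) / (1 + 2 * t))) ^ (t / (1 + t)) •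
        A.hpow ((1 + t) / (1 + 2 * t) - 1) := by
  have h1 : 0 < 1 + t := by have := ht.1; linarith
  have h2 : 0 < 1 + 2 * t := by have := ht.1; linarith
  set p := (1 + t) / (1 + 2 * t) with hp
  obtain ⟨U, a, hU, ha, rfl⟩ := exists_pd hA
  have hN : 0 < trp (DD U a) p := by
    rw [trp_DD hU]
    exact Finset.sum_pos (fun i _ => Real.rpow_pos_of_pos (ha i) _) Finset.univ_nonempty
  refine ⟨hN, DD U (fun i => (trp (DD U a) p)⁻¹ * a i ^ p), ?_, ?_, ?_⟩
  · exact DD_pd hU fun i => mul_pos (inv_pos.2 hN) (Real.rpow_pos_of_pos (ha i) _)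
  · rw [DD_trace hU, ← Finset.mul_sum, ← trp_DD hU, inv_mul_cancel₀ hN.ne', Complex.ofReal_one]
  · rw [hpow_DD hU, hpow_DD hU, DD_smul]
    congr 1
    funext i
    rw [Real.mul_rpow (inv_pos.2 hN).le (Real.rpow_nonneg (ha i).le _), Real.inv_rpow hN.le,
      Real.rpow_neg hN.le, inv_inv, ← Real.rpow_mul (ha i).le]
    congr 2
    rw [hp]
    have h3 : 1 + t * 2 ≠ 0 := by linarith
    field_simp
    ring

end opt

section strong
variable {m : Type*} [Fintype m] [DecidableEq m] {Y : Type*}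

def SM (t : ℝ) (X : Y → Matrix m m ℂ) (M : ℝ) : Set (Matrix m m ℂ) :=
  {Z | ∃ x B, Z = X x * B * (X x)ᴴ ∧ B.PosSemidef ∧ (t < 0 → B.PosDef) ∧
    trp B ((1 + t) / t) ≤ 1 ∧ Z.trace.re ≤ M}

lemma hull_spec {t : ℝ} {W X : Y → Matrix m m ℂ} (hX : ∀ y, W y = X y * (X y)ᴴ) {M : ℝ}
    {K : Matrix m m ℂ} (hK : K ∈ convexHull ℝ (SM t X M)) :
    (K.PosSemidef ∧ K.trace.re ≤ M) ∧ DualWit t W (trp K ((1 + t) / (1 + 2 * t))) := by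
  obtain ⟨ι, _, w, z, hw, hw1, hz, rfl⟩ := mem_convexHull_iff_exists_fintype.1 hK
  choose x B hZ hB hB' hBt hM using hz
  refine ⟨⟨psd_sum_smul w z hw fun i => ?_, ?_⟩, ⟨ι, inferInstance, w, x, fun i => X (x i), B,
    hw, hw1, fun i => hX _, hB, fun h i => hB' i h, hBt, ?_⟩⟩
  · rw [hZ i]; exact (hB i).mul_mul_conjTranspose_same _
  · rw [Matrix.trace_sum, Complex.re_sum]
    calc _ ≤ ∑ i, w i * M := by
          apply Finset.sum_le_sum; intro i _
          rw [Matrix.trace_smul, Complex.smul_re, smul_eq_mul]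
          exact mul_le_mul_of_nonneg_left (hM i) (hw i)
      _ = M := by rw [← Finset.sum_mul, hw1, one_mul]
  · simp only [← hZ]

lemma saddle [Nonempty m] {t : ℝ} (ht : Adm t) {W X : Y → Matrix m m ℂ}
    (hX : ∀ y, W y = X y * (X y)ᴴ) {M : ℝ} (hne : (SM t X M).Nonempty) {c : ℝ} (hc : |c| = 1)
    {ε ρ : ℝ} (hε : 0 < ε) (hρ : 0 < ρ) :
    ∃ (σ K : Matrix m m ℂ) (U : Matrix m m ℂ) (a : m → ℝ) (N E : ℝ), σ.PosDef ∧ σ.trace = 1 ∧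
      DualWit t W (trp K ((1 + t) / (1 + 2 * t))) ∧
      IsU U ∧ (∀ i, 0 ≤ a i) ∧ (∀ i, a i ≤ M) ∧
      trp K ((1 + t) / (1 + 2 * t)) = ∑ i, a i ^ ((1 + t) / (1 + 2 * t)) ∧
      N = ∑ i, (a i + ε) ^ ((1 + t) / (1 + 2 * t)) ∧ 0 < N ∧
      E = ∑ i, (a i + ε) ^ ((1 + t) / (1 + 2 * t) - 1) ∧
      ∀ Z ∈ SM t X M, c * (σ.hpow (-(t / (1 + t))) * Z).trace.re
        ≤ N ^ (t / (1 + t)) * (c * (N - ε * E) + ρ) := by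
  have h1 : 0 < 1 + t := by have := ht.1; linarith
  have h2 : 0 < 1 + 2 * t := by have := ht.1; linarith
  set p := (1 + t) / (1 + 2 * t) with hp
  have hp0 : 0 < p := div_pos h1 h2
  obtain ⟨K, hK, hopt⟩ := near_opt (convexHull ℝ (SM t X M)) (convex_convexHull ℝ _)
    (hne.convexHull) M (fun K hK => (hull_spec hX hK).1) c hc p hε (mul_pos hp0 hρ)
  obtain ⟨⟨hKp, hKM⟩, hKd⟩ := hull_spec hX hK
  obtain ⟨U, a, hU, ha, haM, hKa, hs⟩ := shift_spec (ε := ε) hKp hKM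
  have hpos : ∀ i, 0 < a i + ε := fun i => by linarith [ha i]
  have hApd : (K + ε • (1 : Matrix m m ℂ)).PosDef := by rw [hs]; exact DD_pd hU hpos
  obtain ⟨hN, σ, hσ, hσ1, hσp⟩ := sigma_of ht hApd
  rw [← hp] at hN hσp
  have hNa : trp (K + ε • (1 : Matrix m m ℂ)) p = ∑ i, (a i + ε) ^ p := by rw [hs, trp_DD hU]
  refine ⟨σ, K, U, a, _, _, hσ, hσ1, hKd, hU, ha, haM, by rw [hKa, trp_DD hU], hNa, hN, rfl, ?_⟩
  intro Z hZ
  have h3 := hopt Z (subset_convexHull ℝ _ hZ)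
  rw [Matrix.mul_sub, Matrix.trace_sub, Complex.sub_re] at h3
  have h4 : ((K + ε • (1 : Matrix m m ℂ)).hpow (p - 1) * K).trace.re
      = trp (K + ε • (1 : Matrix m m ℂ)) p - ε * ∑ i, (a i + ε) ^ (p - 1) := by
    rw [hNa, hs, hKa, hpow_DD hU, DD_mul hU, DD_trace hU, Complex.ofReal_re, Finset.mul_sum,
      ← Finset.sum_sub_distrib]
    apply Finset.sum_congr rfl; intro i _
    have : (a i + ε) ^ p = (a i + ε) ^ (p - 1) * (a i + ε) := by
      rw [← Real.rpow_add_one (hpos i).ne']; congr 1; ring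
    rw [this]; ring
  rw [h4] at h3
  rw [hσp, Matrix.smul_mul, Matrix.trace_smul, Complex.smul_re, smul_eq_mul]
  have h5 : p * (c * ((K + ε • (1 : Matrix m m ℂ)).hpow (p - 1) * Z).trace.re)
      ≤ p * (c * (trp (K + ε • (1 : Matrix m m ℂ)) p - ε * ∑ i, (a i + ε) ^ (p - 1)) + ρ) := by
    linarith
  have h6 := le_of_mul_le_mul_left h5 hp0
  have h7 := mul_le_mul_of_nonneg_left h6 (Real.rpow_nonneg hN.le (t / (1 + t)))
  calc _ = trp (K + ε • (1 : Matrix m m ℂ)) p ^ (t / (1 + t)) *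
        (c * ((K + ε • (1 : Matrix m m ℂ)).hpow (p - 1) * Z).trace.re) := by ring
    _ ≤ _ := h7

lemma trace_XBX {W X B V : Matrix m m ℂ} {b : m → ℝ} {M : ℝ} (hX : W = X * Xᴴ) (hW : IsDensity W)
    (hV : IsU V) (hB : B = DD V b) (hb : ∀ i, b i ≤ M) : (X * B * Xᴴ).trace.re ≤ M := by
  have h := trace_mul_le (Matrix.posSemidef_conjTranspose_mul_self X) hV hb
  rw [← hB] at h
  have e1 : (X * B * Xᴴ).trace = (Xᴴ * X * B).trace := by
    rw [Matrix.trace_mul_comm, ← Matrix.mul_assoc]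
  have e2 : (Xᴴ * X).trace = 1 := by rw [Matrix.trace_mul_comm, ← hX, hW.2]
  rw [e1]
  rw [e2] at h
  simpa using h

lemma sandwich_psd {X σ : Matrix m m ℂ} (hσ : σ.PosDef) (r : ℝ) :
    (Xᴴ * σ.hpow r * X).PosSemidef :=
  (hpow_pd hσ r).posSemidef.conjTranspose_mul_mul_same X

lemma trace_shuffle (X S B : Matrix m m ℂ) : (Xᴴ * S * X * B).trace = (S * (X * B * Xᴴ)).trace := by
  rw [show Xᴴ * S * X * B = Xᴴ * (S * (X * B)) by simp only [Matrix.mul_assoc],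
    Matrix.trace_mul_comm]
  simp only [Matrix.mul_assoc]

lemma primal_pos [Nonempty m] [Nonempty Y] {t : ℝ} (ht : Adm t) (ht0 : 0 < t)
    {W : Y → Matrix m m ℂ} (hW : ∀ y, IsDensity (W y)) {v : ℝ} (hv : ∀ κ, DualWit t W κ → κ ≤ v)
    {ρ : ℝ} (hρ : 0 < ρ) : PrimalWit t W ((v + 2 * ρ) ^ (1 + 2 * t)) := by
  have h1 : 0 < 1 + t := by linarith
  have h2 : 0 < 1 + 2 * t := by linarith
  choose X hX using fun y => exists_sqrt (hW y).1
  have hmem : ∀ y (B : Matrix m m ℂ), B.PosSemidef → trp B ((1 + t) / t) ≤ 1 →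
      X y * B * (X y)ᴴ ∈ SM t X 1 := by
    intro y B hB hBt
    refine ⟨y, B, rfl, hB, fun h => absurd h (by linarith), hBt, ?_⟩
    obtain ⟨V, b, hV, hb, rfl⟩ := exists_psd hB
    refine trace_XBX (hX y) (hW y) hV rfl fun i => ?_
    rw [trp_DD hV] at hBt
    have := (Finset.single_le_sum (fun i _ => Real.rpow_nonneg (hb i) _)
      (Finset.mem_univ i)).trans hBt
    by_contra hlt
    exact absurd this (not_le.2 (Real.one_lt_rpow (not_le.1 hlt) (by positivity)))
  obtain ⟨β, hβ, hβt, hβp⟩ := exists_scalarB (m := m) ht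
  have hne : (SM t X 1).Nonempty := ⟨_, hmem (Classical.arbitrary Y) _ hβp.posSemidef hβt⟩
  set p := (1 + t) / (1 + 2 * t) with hp
  have hp0 : 0 < p := div_pos h1 h2
  have hp1 : p ≤ 1 := by rw [hp, div_le_one h2]; linarith
  have hd : (0 : ℝ) < Fintype.card m := by exact_mod_cast Fintype.card_pos
  obtain ⟨ε, hε, hερ⟩ : ∃ ε > 0, Fintype.card m * ε ^ p ≤ ρ := by
    refine ⟨(ρ / Fintype.card m) ^ (1 / p), by positivity, ?_⟩
    rw [← Real.rpow_mul (by positivity), one_div_mul_cancel hp0.ne', Real.rpow_one]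
    field_simp
    exact le_rfl
  obtain ⟨σ, K, U, a, N, E, hσ, hσ1, hKd, hU, ha, haM, hKa, hNa, hN, hE, hmain⟩ :=
    saddle ht hX hne (c := 1) (by simp) hε hρ
  have hNv : N ≤ v + ρ := by
    have : N ≤ ∑ i, a i ^ p + Fintype.card m * ε ^ p := by
      rw [hNa]
      calc _ ≤ ∑ i, (a i ^ p + ε ^ p) := Finset.sum_le_sum fun i _ =>
            Real.rpow_add_le_add_rpow (ha i) hε.le hp0.le hp1
        _ = _ := by rw [Finset.sum_add_distrib]; simp
    have := hv _ hKd
    rw [hKa] at this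
    linarith
  have hE0 : 0 ≤ E := by
    rw [hE]; exact Finset.sum_nonneg fun i _ => Real.rpow_nonneg (by linarith [ha i]) _
  refine ⟨σ, hσ, hσ1, fun y => mul_le_mul_of_nonneg_left ?_ ht0.le⟩
  have hpos := sandwichTr_pos (t := t) (hW y) hσ
  rw [sandwichTr_eq (hX y) hσ] at hpos ⊢
  obtain ⟨B, hB, hBt, hBe⟩ := opt_pos ht0 (sandwich_psd hσ _) hpos
  rw [← hBe, trace_shuffle]
  have h3 := hmain _ (hmem y B hB hBt)
  have h0 : 0 ≤ (σ.hpow (-(t / (1 + t))) * (X y * B * (X y)ᴴ)).trace.re :=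
    trace_mul_nonneg (hpow_pd hσ _).posSemidef (hB.mul_mul_conjTranspose_same _)
  have h4 : (σ.hpow (-(t / (1 + t))) * (X y * B * (X y)ᴴ)).trace.re
      ≤ (v + 2 * ρ) ^ (t / (1 + t) + 1) := by
    have h5 : 0 < v + 2 * ρ := by linarith
    rw [one_mul] at h3
    refine h3.trans ?_
    rw [Real.rpow_add_one h5.ne']
    have : 0 ≤ ε * E := by positivity
    calc _ ≤ N ^ (t / (1 + t)) * (v + 2 * ρ) :=
          mul_le_mul_of_nonneg_left (by linarith) (Real.rpow_nonneg hN.le _)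
      _ ≤ _ := mul_le_mul_of_nonneg_right
          (Real.rpow_le_rpow hN.le (by linarith) (by positivity)) h5.le
  refine (Real.rpow_le_rpow h0 h4 h1.le).trans (le_of_eq ?_)
  rw [← Real.rpow_mul (by linarith)]
  congr 1
  field_simp
  ring

lemma primal_neg [Nonempty m] [Nonempty Y] {t : ℝ} (ht : Adm t) (ht0 : t < 0)
    {W : Y → Matrix m m ℂ} (hW : ∀ y, IsDensity (W y)) {v : ℝ} (hv0 : 0 < v)
    (hv : ∀ κ, DualWit t W κ → v ≤ κ)
    {ρ : ℝ} (hρ : 0 < ρ) (hρv : 2 * ρ < v) :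
    PrimalWit t W (v ^ (1 + 2 * t) * (1 - 2 * ρ / v) ^ (1 + t)
      - Fintype.card m * ρ ^ (1 + t)) := by
  have h1 : 0 < 1 + t := by have := ht.1; linarith
  have h2 : 0 < 1 + 2 * t := by have := ht.1; linarith
  choose X hX using fun y => exists_sqrt (hW y).1
  obtain ⟨M0, hM0⟩ := opt_neg (m := m) ht ht0 hρ
  obtain ⟨β, hβ, hβt, hβp⟩ := exists_scalarB (m := m) ht
  set M := max M0 β with hM
  have hMpos : 0 < M := lt_of_lt_of_le hβ (le_max_right _ _)
  have hne : (SM t X M).Nonempty := by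
    refine ⟨_, Classical.arbitrary Y, _, rfl, hβp.posSemidef, fun _ => hβp, hβt, ?_⟩
    exact trace_XBX (hX _) (hW _) isU_one (DD_const isU_one β).symm fun i => le_max_right _ _
  set p := (1 + t) / (1 + 2 * t) with hp
  have hp1 : 1 ≤ p := by rw [hp, one_le_div h2]; linarith
  have hd : (0 : ℝ) < Fintype.card m := by exact_mod_cast Fintype.card_pos
  obtain ⟨ε, hε, hε1, hερ⟩ : ∃ ε > 0, ε ≤ 1 ∧ ε * (Fintype.card m * (M + 1) ^ (p - 1)) ≤ ρ := by
    have hD : 0 < Fintype.card m * (M + 1) ^ (p - 1) := by positivity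
    refine ⟨min 1 (ρ / (Fintype.card m * (M + 1) ^ (p - 1))), by positivity, min_le_left _ _, ?_⟩
    calc _ ≤ (ρ / (Fintype.card m * (M + 1) ^ (p - 1))) * (Fintype.card m * (M + 1) ^ (p - 1)) :=
          mul_le_mul_of_nonneg_right (min_le_right _ _) hD.le
      _ = ρ := div_mul_cancel₀ _ hD.ne'
  obtain ⟨σ, K, U, a, N, E, hσ, hσ1, hKd, hU, ha, haM, hKa, hNa, hN, hE, hmain⟩ :=
    saddle ht hX hne (c := -1) (by simp) hε hρ
  have hNv : v ≤ N := by
    refine (hv _ hKd).trans ?_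
    rw [hKa, hNa]
    exact Finset.sum_le_sum fun i _ => Real.rpow_le_rpow (ha i) (by linarith) (by linarith)
  have hE1 : ε * E ≤ ρ := by
    refine le_trans (mul_le_mul_of_nonneg_left ?_ hε.le) hερ
    rw [hE]
    calc _ ≤ ∑ _i : m, (M + 1) ^ (p - 1) := Finset.sum_le_sum fun i _ =>
          Real.rpow_le_rpow (by linarith [ha i]) (by linarith [haM i]) (by linarith)
      _ = _ := by simp
  refine ⟨σ, hσ, hσ1, fun y => mul_le_mul_of_nonpos_left ?_ ht0.le⟩
  rw [sandwichTr_eq (hX y) hσ]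
  have htr : ((X y)ᴴ * σ.hpow (-(t / (1 + t))) * X y).trace.re ≤ 1 := by
    obtain ⟨V, b, hV, hb, rfl⟩ := exists_pd hσ
    have e : ((X y)ᴴ * (DD V b).hpow (-(t / (1 + t))) * X y).trace
        = (W y * (DD V b).hpow (-(t / (1 + t)))).trace := by
      rw [Matrix.mul_assoc, Matrix.trace_mul_comm, Matrix.mul_assoc, ← hX, Matrix.trace_mul_comm]
    rw [e, hpow_DD hV]
    have hb1 : ∀ i, b i ≤ 1 := fun i => by
      have h3 : ∑ i, b i = 1 := by
        have := hσ1; rw [DD_trace hV] at this; exact_mod_cast this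
      rw [← h3]
      exact Finset.single_le_sum (fun i _ => (hb i).le) (Finset.mem_univ i)
    have := trace_mul_le (hW y).1 hV (b := fun i => b i ^ (-(t / (1 + t)))) (c := 1) fun i =>
      Real.rpow_le_one (hb i).le (hb1 i) (by
        rw [← neg_div]; exact div_nonneg (by linarith) h1.le)
    rwa [(hW y).2, Complex.one_re, mul_one] at this
  obtain ⟨B, hB, hBt, ⟨V, b, hV, hBV, hbM⟩, hB0, hBe⟩ := hM0 _ (sandwich_psd hσ _) htr
  rw [trace_shuffle] at hBe hB0
  have hmem : X y * B * (X y)ᴴ ∈ SM t X M :=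
    ⟨y, B, rfl, hB.posSemidef, fun _ => hB, hBt,
      trace_XBX (hX y) (hW y) hV hBV fun i => (hbM i).trans (le_max_left _ _)⟩
  have h3 := hmain _ hmem
  have hr : 0 < 1 - 2 * ρ / v := by
    rw [sub_pos, div_lt_one hv0]; exact hρv
  have h4 : v ^ (t / (1 + t) + 1) * (1 - 2 * ρ / v)
      ≤ (σ.hpow (-(t / (1 + t))) * (X y * B * (X y)ᴴ)).trace.re := by
    have h5 : N ^ (t / (1 + t)) * (N - 2 * ρ)
        ≤ (σ.hpow (-(t / (1 + t))) * (X y * B * (X y)ᴴ)).trace.re := by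
      have h6 : N ^ (t / (1 + t)) * (N - 2 * ρ) ≤ N ^ (t / (1 + t)) * (N - ε * E - ρ) :=
        mul_le_mul_of_nonneg_left (by linarith) (Real.rpow_nonneg hN.le _)
      have h7 : N ^ (t / (1 + t)) * (-1 * (N - ε * E) + ρ)
        = - (N ^ (t / (1 + t)) * (N - ε * E - ρ)) := by ring
      linarith
    refine le_trans ?_ h5
    have e : N ^ (t / (1 + t)) * (N - 2 * ρ)
        = N ^ (t / (1 + t) + 1) * (1 - 2 * ρ / N) := by
      rw [Real.rpow_add_one hN.ne']; field_simp
    rw [e]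
    apply mul_le_mul _ _ hr.le (Real.rpow_nonneg hN.le _)
    · apply Real.rpow_le_rpow hv0.le hNv
      have : t / (1 + t) + 1 = (1 + 2 * t) / (1 + t) := by field_simp; ring
      rw [this]; positivity
    · have : 2 * ρ / N ≤ 2 * ρ / v := div_le_div_of_nonneg_left (by linarith) hv0 hNv
      linarith
  have h8 := (Real.rpow_le_rpow (mul_nonneg (Real.rpow_nonneg hv0.le _) hr.le) h4 h1.le).trans hBe
  rw [Real.mul_rpow (Real.rpow_nonneg hv0.le _) hr.le, ← Real.rpow_mul hv0.le,
    show (t / (1 + t) + 1) * (1 + t) = 1 + 2 * t by field_simp; ring] at h8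
  linarith

end strong


section final
variable {m : Type*} [Fintype m] [DecidableEq m] {Y : Type*}

lemma exists_primal [Nonempty m] [Nonempty Y] [Finite Y] (t : ℝ)
    {W : Y → Matrix m m ℂ} (hW : ∀ y, IsDensity (W y)) : ∃ c > 0, PrimalWit t W c := by
  obtain ⟨σ, hσ, hσ1⟩ := exists_sigma (m := m)
  obtain ⟨y0, hy0⟩ := Finite.exists_max (fun y => t * sandwichTr t (W y) σ)
  exact ⟨sandwichTr t (W y0) σ, sandwichTr_pos (hW y0) hσ, σ, hσ, hσ1, hy0⟩

lemma exists_dual [Nonempty m] [Nonempty Y] {t : ℝ} (ht : Adm t)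
    {W : Y → Matrix m m ℂ} (hW : ∀ y, IsDensity (W y)) : ∃ κ > 0, DualWit t W κ := by
  obtain ⟨β, hβ, hβt, hβp⟩ := exists_scalarB (m := m) ht
  obtain ⟨y⟩ := ‹Nonempty Y›
  obtain ⟨X, hX⟩ := exists_sqrt (hW y).1
  refine ⟨_, ?_, Unit, inferInstance, fun _ => 1, fun _ => y, fun _ => X,
    fun _ => β • (1 : Matrix m m ℂ), fun _ => zero_le_one, by simp, fun _ => hX,
    fun _ => hβp.posSemidef, fun _ _ => hβp, fun _ => hβt, rfl⟩
  apply trp_pos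
  · exact psd_sum_smul _ _ (fun _ => zero_le_one) fun _ =>
      hβp.posSemidef.mul_mul_conjTranspose_same _
  · simp only [Finset.univ_unique, Finset.sum_singleton, one_smul]
    rw [Matrix.mul_smul, Matrix.mul_one, Matrix.smul_mul, ← hX, Matrix.trace_smul, (hW y).2]
    simpa using hβ

lemma dual_nonneg {t : ℝ} {W : Y → Matrix m m ℂ} {κ : ℝ} (h : DualWit t W κ) : 0 ≤ κ := by
  obtain ⟨ι, _, p, y, X, B, hp, hp1, hX, hB, hB', hBt, rfl⟩ := h
  exact trp_nonneg (psd_sum_smul _ _ hp fun i => (hB i).mul_mul_conjTranspose_same _) _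

lemma strong_duality [Nonempty m] [Nonempty Y] [Finite Y] {t : ℝ} (ht : Adm t)
    {W : Y → Matrix m m ℂ} (hW : ∀ y, IsDensity (W y)) :
    ∃ v > 0, (∀ s ∈ nhds v, ∃ κ ∈ s, DualWit t W κ) ∧
      (∀ s ∈ nhds (v ^ (1 + 2 * t)), ∃ c ∈ s, PrimalWit t W c) := by
  have h1 : 0 < 1 + t := by have := ht.1; linarith
  have h2 : 0 < 1 + 2 * t := by have := ht.1; linarith
  obtain ⟨c0, hc0, hP⟩ := exists_primal t hW
  obtain ⟨κ0, hκ0, hD⟩ := exists_dual ht hW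
  set D : Set ℝ := {κ | DualWit t W κ} with hDd
  have hne : D.Nonempty := ⟨κ0, hD⟩
  rcases lt_or_gt_of_ne ht.2 with ht0 | ht0
  · have hlb : ∀ κ ∈ D, c0 ^ (1 / (1 + 2 * t)) ≤ κ := by
      intro κ hκ
      have h3 := wit_le ht hκ hP
      have h4 : c0 ≤ κ ^ (1 + 2 * t) := by nlinarith
      have h5 := Real.rpow_le_rpow hc0.le h4 (show 0 ≤ 1 / (1 + 2 * t) by positivity)
      rwa [← Real.rpow_mul (dual_nonneg hκ), mul_one_div_cancel h2.ne', Real.rpow_one] at h5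
    have hbdd : BddBelow D := ⟨_, hlb⟩
    have hv0 : 0 < sInf D := lt_of_lt_of_le (Real.rpow_pos_of_pos hc0 _) (le_csInf hne hlb)
    refine ⟨sInf D, hv0, ?_, ?_⟩
    · intro s hs
      have := mem_closure_iff_nhds.1 (csInf_mem_closure hne hbdd) s hs
      obtain ⟨κ, h3, h4⟩ := this
      exact ⟨κ, h3, h4⟩
    · set v := sInf D with hv
      have hcont : ContinuousAt (fun ρ : ℝ => v ^ (1 + 2 * t) * (1 - 2 * ρ / v) ^ (1 + t)
          - Fintype.card m * ρ ^ (1 + t)) 0 := by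
        apply ContinuousAt.sub
        · apply ContinuousAt.mul continuousAt_const
          apply ContinuousAt.rpow_const
          · fun_prop
          · right; exact h1.le
        · apply ContinuousAt.mul continuousAt_const
          exact Real.continuousAt_rpow_const _ _ (Or.inr h1.le)
      intro s hs
      have e : v ^ (1 + 2 * t) * (1 - 2 * 0 / v) ^ (1 + t) - Fintype.card m * (0 : ℝ) ^ (1 + t)
          = v ^ (1 + 2 * t) := by
        rw [Real.zero_rpow h1.ne']; simp
      have h3 := hcont.tendsto
      rw [e] at h3
      have h4 : ∀ᶠ ρ : ℝ in nhdsWithin 0 (Set.Ioi 0), v ^ (1 + 2 * t) * (1 - 2 * ρ / v) ^ (1 + t)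
          - Fintype.card m * ρ ^ (1 + t) ∈ s :=
        (h3.mono_left nhdsWithin_le_nhds).eventually_mem hs
      have h5 : ∀ᶠ ρ : ℝ in nhdsWithin 0 (Set.Ioi 0), ρ ∈ Set.Ioo 0 (v / 2) :=
        Ioo_mem_nhdsGT (by linarith)
      obtain ⟨ρ, h6, h7⟩ := (h4.and h5).exists
      exact ⟨_, h6, primal_neg ht ht0 hW hv0 (fun κ hκ => csInf_le hbdd hκ) h7.1
        (by linarith [h7.2])⟩
  · have hub : ∀ κ ∈ D, κ ≤ c0 ^ (1 / (1 + 2 * t)) := by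
      intro κ hκ
      have h3 := wit_le ht hκ hP
      have h4 : κ ^ (1 + 2 * t) ≤ c0 := le_of_mul_le_mul_left h3 ht0
      have h5 := Real.rpow_le_rpow (Real.rpow_nonneg (dual_nonneg hκ) _) h4
        (show 0 ≤ 1 / (1 + 2 * t) by positivity)
      rwa [← Real.rpow_mul (dual_nonneg hκ), mul_one_div_cancel h2.ne', Real.rpow_one] at h5
    have hbdd : BddAbove D := ⟨_, hub⟩
    have hv0 : 0 < sSup D := lt_of_lt_of_le hκ0 (le_csSup hbdd hD)
    refine ⟨sSup D, hv0, ?_, ?_⟩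
    · intro s hs
      obtain ⟨κ, h3, h4⟩ := mem_closure_iff_nhds.1 (csSup_mem_closure hne hbdd) s hs
      exact ⟨κ, h3, h4⟩
    · set v := sSup D with hv
      have hcont : ContinuousAt (fun ρ : ℝ => (v + 2 * ρ) ^ (1 + 2 * t)) 0 := by
        apply ContinuousAt.rpow_const
        · fun_prop
        · right; exact h2.le
      intro s hs
      have h3 := hcont.tendsto
      rw [mul_zero, add_zero] at h3
      have h4 : ∀ᶠ ρ : ℝ in nhdsWithin 0 (Set.Ioi 0), (v + 2 * ρ) ^ (1 + 2 * t) ∈ s :=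
        (h3.mono_left nhdsWithin_le_nhds).eventually_mem hs
      obtain ⟨ρ, h6, h7⟩ := (h4.and self_mem_nhdsWithin).exists
      exact ⟨_, h6, primal_pos ht ht0 hW (fun κ hκ => le_csSup hbdd hκ) h7⟩

lemma sup_prod {X : Type*} [Fintype X] [Nonempty X] {d : ℕ} {t : ℝ} (ht : Adm t)
    (W : X → Matrix (Fin d) (Fin d) ℂ) (hW : ∀ x, IsDensity (W x)) :
    ∃ L, (⨆ Q : {Q : X → ℝ // IsProbDist Q}, ItildeDown t W Q.1) = L ∧
      ∀ n : ℕ, (⨆ Q : {Q : (Fin n → X) → ℝ // IsProbDist Q}, ItildeDown t (prodChannel W n) Q.1)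
        = n * L := by
  have hm : Nonempty (Fin d) := dens_nonempty (hW (Classical.arbitrary X))
  obtain ⟨v, hv, hD, hP⟩ := strong_duality ht hW
  have hV : 0 < v ^ (1 + 2 * t) := Real.rpow_pos_of_pos hv _
  -- primal approximations
  have kP : ∀ δ > 0, ∃ c > 0, (1 / t) * Real.logb 2 c
      ≤ (1 / t) * Real.logb 2 (v ^ (1 + 2 * t)) + δ ∧ PrimalWit t W c := by
    intro δ hδ
    have hc : ContinuousAt (fun c : ℝ => (1 / t) * Real.logb 2 c) (v ^ (1 + 2 * t)) :=
      continuousAt_const.mul (Real.continuousAt_logb hV.ne')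
    have h1 := hc.eventually_lt_const (lt_add_of_pos_right _ hδ)
    obtain ⟨c, ⟨h3, h4⟩, h5⟩ := hP _ (h1.and (eventually_gt_nhds hV))
    exact ⟨c, h4, h3.le, h5⟩
  have kD : ∀ δ > 0, ∃ κ > 0, (1 / t) * Real.logb 2 (v ^ (1 + 2 * t)) - δ
      ≤ (1 / t) * Real.logb 2 (κ ^ (1 + 2 * t)) ∧ DualWit t W κ := by
    intro δ hδ
    have hc : ContinuousAt (fun κ : ℝ => (1 / t) * Real.logb 2 (κ ^ (1 + 2 * t))) v := by
      apply continuousAt_const.mul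
      exact ContinuousAt.comp' (f := fun κ : ℝ => κ ^ (1 + 2 * t)) (g := Real.logb 2)
        (Real.continuousAt_logb hV.ne') (Real.continuousAt_rpow_const _ _ (Or.inl hv.ne'))
    have h1 := hc.eventually_const_lt (sub_lt_self _ hδ)
    obtain ⟨c, ⟨h3, h4⟩, h5⟩ := hD _ (h1.and (eventually_gt_nhds hv))
    exact ⟨c, h4, h3.le, h5⟩
  refine ⟨(1 / t) * Real.logb 2 (v ^ (1 + 2 * t)), sup_eq ht hW _ kP kD, fun n => ?_⟩
  have hn : (0 : ℝ) ≤ n := Nat.cast_nonneg n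
  have hδn : ∀ δ : ℝ, 0 < δ → (n : ℝ) * (δ / (n + 1)) ≤ δ := by
    intro δ hδ
    rw [mul_div_assoc', div_le_iff₀ (by positivity)]
    nlinarith
  apply sup_eq ht (fun y => prod_density hW n y)
  · intro δ hδ
    obtain ⟨c, hc, h1, h2⟩ := kP (δ / (n + 1)) (by positivity)
    refine ⟨c ^ n, by positivity, ?_, primal_tensor ht.2 hc hW h2 n⟩
    rw [Real.logb_pow]
    have h3 := mul_le_mul_of_nonneg_left h1 hn
    have := hδn δ hδ
    linarith
  · intro δ hδ
    obtain ⟨κ, hκ, h1, h2⟩ := kD (δ / (n + 1)) (by positivity)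
    refine ⟨κ ^ n, by positivity, ?_, dual_tensor h2 n⟩
    have e : (κ ^ n) ^ (1 + 2 * t) = (κ ^ (1 + 2 * t)) ^ n := by
      rw [← Real.rpow_natCast, ← Real.rpow_natCast, ← Real.rpow_mul hκ.le, ← Real.rpow_mul hκ.le,
        mul_comm]
    rw [e, Real.logb_pow]
    have h3 := mul_le_mul_of_nonneg_left h1 hn
    have := hδn δ hδ
    linarith

lemma hpow_one_eq (r : ℝ) : (1 : Matrix m m ℂ).hpow r = 1 := by
  have h := hpow_DD (m := m) isU_one (a := fun _ => (1 : ℝ)) r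
  rw [DD_const isU_one, one_smul] at h
  rw [h]
  simp only [Real.one_rpow]
  rw [DD_const isU_one, one_smul]

lemma eq_one_of_unique [Unique m] {σ : Matrix m m ℂ} (h : σ.trace = 1) : σ = 1 := by
  ext i j
  rw [Matrix.trace, Fintype.sum_unique] at h
  rw [Unique.eq_default i, Unique.eq_default j]
  simpa using h

lemma sup_empty_zero {X : Type*} [Fintype X] [IsEmpty X] {d : ℕ} (t : ℝ)
    (W : X → Matrix (Fin d) (Fin d) ℂ) :
    (⨆ Q : {Q : (Fin 0 → X) → ℝ // IsProbDist Q}, ItildeDown t (prodChannel W 0) Q.1) = 0 := by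
  have h : ∀ Q : {Q : (Fin 0 → X) → ℝ // IsProbDist Q},
      ItildeDown t (prodChannel W 0) Q.1 = 0 := by
    intro Q
    have h2 : ∀ σ : {σ : Matrix (Fin 0 → Fin d) (Fin 0 → Fin d) ℂ // σ.PosDef ∧ σ.trace = 1},
        (1 / t) * Real.logb 2 (∑ x, Q.1 x * sandwichTr t (prodChannel W 0 x) σ.1) = 0 := by
      intro σ
      have e1 : σ.1 = 1 := eq_one_of_unique σ.2.2
      have e2 : ∀ x, prodChannel W 0 x = 1 := fun x => by
        apply eq_one_of_unique
        simp [prodChannel, Matrix.trace]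
      have e3 : ∀ x, sandwichTr t (prodChannel W 0 x) σ.1 = 1 := fun x => by
        rw [e1, e2, sandwichTr, hpow_one_eq, mul_one, mul_one, hpow_one_eq]
        simp
      simp only [e3, mul_one, Q.2.2]
      simp
    unfold ItildeDown
    simp only [h2]
    exact Real.iInf_const_zero
  simp only [h]
  exact Real.iSup_const_zero

end final

/-- Additivity of the optimized sandwiched Rényi mutual information for
product channels. -/
theorem ItildeDown_additive
    {X : Type*} [Fintype X] {d : ℕ}
    (W : X → Matrix (Fin d) (Fin d) ℂ) (hW : ∀ x, IsDensity (W x))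
    (n : ℕ) (t : ℝ) (ht : t ∈ Set.Ioo (-(1/2) : ℝ) 0 ∪ Set.Ioi (0 : ℝ)) :
    (⨆ Q : {Q : (Fin n → X) → ℝ // IsProbDist Q}, ItildeDown t (prodChannel W n) Q.1)
      = (n : ℝ) * ⨆ Q : {Q : X → ℝ // IsProbDist Q}, ItildeDown t W Q.1 := by
  have ha : Adm t := by
    rcases ht with h | h
    · exact ⟨h.1, h.2.ne⟩
    · have h0 : (0 : ℝ) < t := h
      exact ⟨by linarith, h0.ne'⟩
  rcases isEmpty_or_nonempty X with hX | hX
  · rcases Nat.eq_zero_or_pos n with rfl | hn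
    · rw [sup_empty_zero]; simp
    · have : Nonempty (Fin n) := ⟨⟨0, hn⟩⟩
      have k1 : IsEmpty {Q : X → ℝ // IsProbDist Q} := ⟨fun Q => by
        have := Q.2.2; simp at this⟩
      have k2 : IsEmpty {Q : (Fin n → X) → ℝ // IsProbDist Q} := ⟨fun Q => by
        have := Q.2.2; simp at this⟩
      rw [Real.iSup_of_isEmpty, Real.iSup_of_isEmpty, mul_zero]
  · obtain ⟨L, h1, h2⟩ := sup_prod ha W hW
    rw [h1, h2]

end
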